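/- arXiv:2604.00680 — 3 statements merged into one kernel-verified Lean document; each statement's English description precedes it below -/
import Mathlib

section
/- (Lemma 3 of the paper.) Let A ∈ ℝ^{n×n}, C ∈ ℝ^{p×n}, K ∈ ℝ^{r×n}, and assume the pair (A, C) is partially detectable with respect to K, i.e., for every λ ∈ ℂ with Re λ ≥ 0, every v ∈ ℂⁿ with C(λI−A)^j v = 0 for all j = 0,…,n−1 and (λI−A)^n v = 0 satisfies Kv = 0. Then there exist a nonnegative integer q and matrices T ∈ ℝ^{q×n} and L ∈ ℝ^{q×p} such that, setting N := (TA − LC)Tᵀ: (1) every complex eigenvalue of N has negative real part; and (2) NT + LC = TA and KTᵀT = K. -/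
open Matrix

theorem nonpos_of_forall_mul_lt {a u : ℝ} (h : ∀ t : ℝ, 0 < t → t * a < u) : a ≤ 0 := by
  by_contra! ha
  have h1 := h ((|u| + 1) / a) (by positivity)
  rw [div_mul_cancel₀ _ ha.ne'] at h1
  linarith [le_abs_self u]

theorem nonpos_of_forall_le_mul {a u : ℝ} (h : ∀ t : ℝ, 0 < t → u ≤ t * a) : u ≤ 0 := by
  by_contra! hu
  have h1 := h (u / (2 * (|a| + 1))) (by positivity)
  rw [div_mul_eq_mul_div, le_div_iff₀ (by positivity)] at h1
  nlinarith [le_abs_self a, abs_nonneg a]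

theorem nonneg_of_forall_le_mul {a u : ℝ} (h : ∀ t : ℝ, 0 < t → u ≤ t * a) : 0 ≤ a := by
  have : -a ≤ 0 := nonpos_of_forall_mul_lt (u := -u + 1) fun t ht => by
    linarith [h t ht]
  linarith

/-- Square matrices, not necessarily symmetric, with negative definite quadratic form. -/
def negDefiniteForms (q : ℕ) : Set (Matrix (Fin q) (Fin q) ℝ) :=
  {M | ∀ x : Fin q → ℝ, x ≠ 0 → x ⬝ᵥ M *ᵥ x < 0}

theorem smul_mem_negDefiniteForms {q : ℕ} {M : Matrix (Fin q) (Fin q) ℝ}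
    (hM : M ∈ negDefiniteForms q) {t : ℝ} (ht : 0 < t) : t • M ∈ negDefiniteForms q := by
  intro x hx
  have := hM x hx
  simp only [smul_mulVec, dotProduct_smul, smul_eq_mul]
  nlinarith

theorem convex_negDefiniteForms (q : ℕ) : Convex ℝ (negDefiniteForms q) := by
  intro M hM N hN a b ha hb hab x hx
  have h1 := hM x hx
  have h2 := hN x hx
  simp only [add_mulVec, smul_mulVec, dotProduct_add, dotProduct_smul, smul_eq_mul]
  rcases ha.eq_or_lt with rfl | ha
  · have : b = 1 := by linarith
    subst this; linarith
  · nlinarith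

theorem isOpen_negDefiniteForms (q : ℕ) : IsOpen (negDefiniteForms q) := by
  have h : negDefiniteForms q =
      {M | ∀ x ∈ Metric.sphere (0 : Fin q → ℝ) 1, x ⬝ᵥ M *ᵥ x < 0} := by
    ext M
    refine ⟨fun h x hx => h x ?_, fun h x hx => ?_⟩
    · rintro rfl
      simp at hx
    · have hn : 0 < ‖x‖ := norm_pos_iff.2 hx
      have := h (‖x‖⁻¹ • x) (by simp [norm_smul, hn.ne'])
      simp only [mulVec_smul, dotProduct_smul, smul_dotProduct, smul_eq_mul] at this
      by_contra! hc
      exact absurd this (not_lt.2 (by positivity))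
  rw [h, isOpen_iff_mem_nhds]
  intro M hM
  refine (isCompact_sphere (0 : Fin q → ℝ) 1).eventually_forall_of_forall_eventually
    fun x hx => ?_
  have hc : Continuous fun z : Matrix (Fin q) (Fin q) ℝ × (Fin q → ℝ) =>
      z.2 ⬝ᵥ z.1 *ᵥ z.2 := by fun_prop
  exact hc.continuousAt.eventually_lt continuousAt_const (hM x hx)

/-- A linear functional on matrices is the entrywise pairing with a matrix. -/
theorem linearMap_apply_vecMulVec {q : ℕ} (f : Matrix (Fin q) (Fin q) ℝ →ₗ[ℝ] ℝ)
    (x y : Fin q → ℝ) :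
    f (vecMulVec x y) = x ⬝ᵥ (Matrix.of fun i j => f (single i j 1)) *ᵥ y := by
  rw [matrix_eq_sum_single (vecMulVec x y)]
  simp only [map_sum, dotProduct, mulVec, Finset.mul_sum, of_apply]
  refine Finset.sum_congr rfl fun i _ => Finset.sum_congr rfl fun j _ => ?_
  have : single i j (vecMulVec x y i j) = (x i * y j) • single i j (1 : ℝ) := by
    simp [vecMulVec_apply]
  rw [this, map_smul, smul_eq_mul]
  ring

/-- Either the pair `(A, C)` has a quadratic detectability certificate `(X, γ)`, or there is a
nonzero positive semidefinite `Z` with `C Z = 0` and `A Z + Z Aᵀ ≥ 0`. -/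
theorem exists_lyapunov_certificate_or_dual {q p : ℕ} (A : Matrix (Fin q) (Fin q) ℝ)
    (C : Matrix (Fin p) (Fin q) ℝ) :
    (∃ (X : Matrix (Fin q) (Fin q) ℝ) (γ : ℝ), X.PosDef ∧
      X * A - γ • (Cᵀ * C) ∈ negDefiniteForms q) ∨
    ∃ Z : Matrix (Fin q) (Fin q) ℝ, Z.PosSemidef ∧ Z ≠ 0 ∧
      (∀ u : Fin q → ℝ, 0 ≤ u ⬝ᵥ Z *ᵥ (Aᵀ *ᵥ u)) ∧ C * Z = 0 := by
  rw [or_iff_not_imp_left]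
  intro hno
  let S : Set (Matrix (Fin q) (Fin q) ℝ) :=
    {M | ∃ (X : Matrix (Fin q) (Fin q) ℝ) (γ : ℝ), X.PosDef ∧ X * A - γ • (Cᵀ * C) = M}
  have hSmul : ∀ M ∈ S, ∀ t : ℝ, 0 < t → t • M ∈ S := by
    rintro _ ⟨X, γ, hX, rfl⟩ t ht
    exact ⟨t • X, t * γ, hX.smul ht, by simp [smul_sub, smul_smul]⟩
  have hSadd : ∀ M ∈ S, ∀ N ∈ S, M + N ∈ S := by
    rintro _ ⟨X, γ, hX, rfl⟩ _ ⟨Y, δ, hY, rfl⟩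
    exact ⟨X + Y, γ + δ, hX.add hY, by rw [add_mul, add_smul]; abel⟩
  have hSconv : Convex ℝ S := by
    refine convex_iff_forall_pos.2 fun M hM N hN a b ha hb _ => ?_
    exact hSadd _ (hSmul _ hM _ ha) _ (hSmul _ hN _ hb)
  have hdisj : Disjoint (negDefiniteForms q) S := by
    rw [Set.disjoint_left]
    rintro _ hN ⟨X, γ, hX, rfl⟩
    exact hno ⟨X, γ, hX, hN⟩
  obtain ⟨f, u, hf, hg⟩ := geometric_hahn_banach_open (convex_negDefiniteForms q)
    (isOpen_negDefiniteForms q) hSconv hdisj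
  have hN : ∀ M ∈ negDefiniteForms q, f M ≤ 0 := fun M hM =>
    nonpos_of_forall_mul_lt (u := u) fun t ht => by
      simpa using hf _ (smul_mem_negDefiniteForms hM ht)
  have hS' : ∀ M ∈ S, ∀ t : ℝ, 0 < t → u ≤ t * f M := fun M hM t ht => by
    simpa using hg _ (hSmul M hM t ht)
  have hS : ∀ (X : Matrix (Fin q) (Fin q) ℝ) (γ : ℝ), X.PosDef →
      0 ≤ f (X * A) - γ * f (Cᵀ * C) := fun X γ hX => by
    simpa using nonneg_of_forall_le_mul (hS' _ ⟨X, γ, hX, rfl⟩)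
  have hu : u ≤ 0 := nonpos_of_forall_le_mul (hS' _ ⟨1, 0, PosDef.one, rfl⟩)
  have hneg : (-1 : Matrix (Fin q) (Fin q) ℝ) ∈ negDefiniteForms q := fun x hx => by
    simpa [neg_mulVec] using (dotProduct_star_self_pos_iff (v := x)).2 hx
  have hCC : f (Cᵀ * C) = 0 := by
    have h1 := fun γ => hS 1 γ PosDef.one
    by_contra h0
    have h2 := h1 ((f (1 * A) + 1) / f (Cᵀ * C))
    rw [div_mul_cancel₀ _ h0] at h2
    linarith
  set Z : Matrix (Fin q) (Fin q) ℝ := Matrix.of fun i j => f (single i j 1)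
  have hZ : ∀ x y, f (vecMulVec x y) = x ⬝ᵥ Z *ᵥ y :=
    linearMap_apply_vecMulVec (f : Matrix (Fin q) (Fin q) ℝ →ₗ[ℝ] ℝ)
  have hskew : ∀ i j, f (single i j 1) = f (single j i 1) := by
    intro i j
    have key : ∀ t : ℝ, f (-1) + t * (f (single i j 1) - f (single j i 1)) ≤ 0 := by
      intro t
      have := hN (-1 + t • (single i j 1 - single j i 1)) fun x hx => by
        have h1 := hneg x hx
        have h2 : x ⬝ᵥ (single i j (1 : ℝ) - single j i 1) *ᵥ x = 0 := by
          simp [sub_mulVec, single_mulVec, dotProduct, Function.update_apply, mul_sub,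
            mul_comm]
        simp only [add_mulVec, smul_mulVec, dotProduct_add, dotProduct_smul, h2]
        simpa using h1
      simpa using this
    by_contra h0
    have h0' := sub_ne_zero.2 h0
    have := key ((-f (-1) + 1) / (f (single i j 1) - f (single j i 1)))
    rw [div_mul_cancel₀ _ h0'] at this
    linarith
  have hsymm : Zᵀ = Z := by
    ext i j
    exact hskew j i
  have hpsd : ∀ x, 0 ≤ x ⬝ᵥ Z *ᵥ x := by
    intro x
    refine nonneg_of_forall_le_mul (u := f (-1)) fun t ht => ?_
    have := hN (-1 + t • (-vecMulVec x x)) fun y hy => by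
      have h1 := hneg y hy
      have h2 : y ⬝ᵥ (vecMulVec x x) *ᵥ y = (y ⬝ᵥ x) ^ 2 := by
        rw [vecMulVec_mulVec]
        simp [dotProduct_comm x y, sq]
      simp only [add_mulVec, smul_mulVec, dotProduct_add, dotProduct_smul,
        neg_mulVec _ (vecMulVec x x), dotProduct_neg, h2, smul_eq_mul]
      nlinarith [sq_nonneg (y ⬝ᵥ x)]
    simpa [hZ] using this
  have hPSD : Z.PosSemidef := PosSemidef.of_dotProduct_mulVec_nonneg
    (by ext i j; exact hskew j i) (by simpa using hpsd)
  refine ⟨Z, hPSD, fun h0 => ?_, fun v => ?_, ?_⟩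
  · have h1 := hf _ hneg
    have : f (-1) = 0 := by
      have h2 : (1 : Matrix (Fin q) (Fin q) ℝ) =
          ∑ i, vecMulVec (Pi.single i 1) (Pi.single i 1) := by
        ext i j
        simp [Matrix.sum_apply, vecMulVec_apply, one_apply, Pi.single_apply]
      rw [map_neg, h2, map_sum]
      simp [hZ, h0]
    linarith
  · have h1 : v ⬝ᵥ Z *ᵥ (Aᵀ *ᵥ v) = f (vecMulVec v v * A) := by
      rw [vecMulVec_mul, hZ, mulVec_transpose]
    rw [h1]
    refine nonneg_of_forall_le_mul (u := -f A) fun t ht => ?_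
    have h2 : (1 + t • vecMulVec v v).PosDef := by
      refine PosDef.one.add_posSemidef (PosSemidef.smul ?_ ht.le)
      simpa using posSemidef_vecMulVec_self_star v
    have := hS _ 0 h2
    simp [add_mul] at this
    linarith
  · have h1 : Cᵀ * C = ∑ i, vecMulVec (C i) (C i) := by
      ext i j
      simp [Matrix.sum_apply, vecMulVec_apply, mul_apply]
    rw [h1, map_sum] at hCC
    simp only [hZ] at hCC
    rw [Finset.sum_eq_zero_iff_of_nonneg fun i _ => hpsd (C i)] at hCC
    ext i j
    have h2 : Z *ᵥ C i = 0 := by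
      rw [← hPSD.dotProduct_mulVec_zero_iff]
      simpa using hCC i (Finset.mem_univ i)
    have h3 := congrFun h2 j
    rw [← hsymm] at h3
    simpa [mul_apply, mulVec, dotProduct, mul_comm] using h3

theorem re_map_mulVec {m n : ℕ} (M : Matrix (Fin m) (Fin n) ℝ) (v : Fin n → ℂ) :
    (fun i => ((M.map Complex.ofReal *ᵥ v) i).re) = M *ᵥ fun i => (v i).re := by
  ext i
  simp [mulVec, dotProduct]

theorem im_map_mulVec {m n : ℕ} (M : Matrix (Fin m) (Fin n) ℝ) (v : Fin n → ℂ) :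
    (fun i => ((M.map Complex.ofReal *ᵥ v) i).im) = M *ᵥ fun i => (v i).im := by
  ext i
  simp [mulVec, dotProduct]

/-- Real and imaginary parts of the equation `M v = μ v`. -/
theorem re_im_eq_of_map_mulVec_eq_smul {n : ℕ} {M : Matrix (Fin n) (Fin n) ℝ} {v : Fin n → ℂ}
    {μ : ℂ} (h : M.map Complex.ofReal *ᵥ v = μ • v) :
    (M *ᵥ fun i => (v i).re) = (μ.re • fun i => (v i).re) - (μ.im • fun i => (v i).im) ∧
    (M *ᵥ fun i => (v i).im) = (μ.im • fun i => (v i).re) + μ.re • fun i => (v i).im := by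
  rw [← re_map_mulVec, ← im_map_mulVec, h]
  constructor <;> ext i <;> simp
  ring

theorem re_ne_zero_or_im_ne_zero {n : ℕ} {v : Fin n → ℂ} (hv : v ≠ 0) :
    (fun i => (v i).re) ≠ 0 ∨ (fun i => (v i).im) ≠ 0 := by
  by_contra! h
  exact hv (funext fun i => Complex.ext (congrFun h.1 i) (congrFun h.2 i))

theorem dotProduct_mulVec_comm_of_transpose_eq {n : ℕ} {X : Matrix (Fin n) (Fin n) ℝ}
    (hX : Xᵀ = X) (x y : Fin n → ℝ) : x ⬝ᵥ X *ᵥ y = y ⬝ᵥ X *ᵥ x := by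
  rw [dotProduct_mulVec, ← mulVec_transpose, hX, dotProduct_comm]

theorem transpose_eq_of_posSemidef {n : ℕ} {X : Matrix (Fin n) (Fin n) ℝ} (hX : X.PosSemidef) :
    Xᵀ = X :=
  (conjTranspose_eq_transpose_of_trivial X).symm.trans hX.isHermitian

/-- Lyapunov's criterion. -/
theorem re_neg_of_mem_spectrum_of_lyapunov {n : ℕ} {M X : Matrix (Fin n) (Fin n) ℝ}
    (hX : X.PosDef) (hXM : X * M ∈ negDefiniteForms n) :
    ∀ μ ∈ spectrum ℂ (M.map Complex.ofReal), μ.re < 0 := by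
  intro μ hμ
  rw [← spectrum_toLin', ← Module.End.hasEigenvalue_iff_mem_spectrum] at hμ
  obtain ⟨v, hv⟩ := hμ.exists_hasEigenvector
  obtain ⟨hre, him⟩ := re_im_eq_of_map_mulVec_eq_smul
    (show M.map Complex.ofReal *ᵥ v = μ • v by simpa using hv.apply_eq_smul)
  have hne := re_ne_zero_or_im_ne_zero hv.2
  set x : Fin n → ℝ := fun i => (v i).re
  set y : Fin n → ℝ := fun i => (v i).im
  have hsym : x ⬝ᵥ X *ᵥ y = y ⬝ᵥ X *ᵥ x :=
    dotProduct_mulVec_comm_of_transpose_eq (transpose_eq_of_posSemidef hX.posSemidef) x y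
  have hx : x ⬝ᵥ (X * M) *ᵥ x = μ.re * (x ⬝ᵥ X *ᵥ x) - μ.im * (x ⬝ᵥ X *ᵥ y) := by
    rw [← mulVec_mulVec, hre]
    simp [mulVec_sub, mulVec_smul]
  have hy : y ⬝ᵥ (X * M) *ᵥ y = μ.im * (y ⬝ᵥ X *ᵥ x) + μ.re * (y ⬝ᵥ X *ᵥ y) := by
    rw [← mulVec_mulVec, him]
    simp [mulVec_add, mulVec_smul]
  have hpos : ∀ z : Fin n → ℝ, 0 ≤ z ⬝ᵥ X *ᵥ z := fun z => by
    simpa using hX.posSemidef.dotProduct_mulVec_nonneg z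
  have hnonpos : ∀ z : Fin n → ℝ, z ⬝ᵥ (X * M) *ᵥ z ≤ 0 := fun z => by
    rcases eq_or_ne z 0 with rfl | hz
    · simp
    · exact (hXM z hz).le
  have hlt : x ⬝ᵥ (X * M) *ᵥ x + y ⬝ᵥ (X * M) *ᵥ y < 0 := by
    rcases hne with h | h
    · linarith [hXM x h, hnonpos y]
    · linarith [hXM y h, hnonpos x]
  rw [hx, hy, hsym] at hlt
  by_contra! h0
  nlinarith [mul_nonneg h0 (hpos x), mul_nonneg h0 (hpos y)]

/-- Every complex eigenvector `x + i y` of `A` with `x, y ∈ V` has an eigenvalue `a + i b` with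
`a ≥ 0`. -/
def IsAntistableOn {n : ℕ} (A : Matrix (Fin n) (Fin n) ℝ) (V : Submodule ℝ (Fin n → ℝ)) : Prop :=
  ∀ x ∈ V, ∀ y ∈ V, ∀ a b : ℝ, (x ≠ 0 ∨ y ≠ 0) → A *ᵥ x = a • x - b • y →
    A *ᵥ y = b • x + a • y → 0 ≤ a

theorem isAntistableOn_range {n : ℕ} {A Z : Matrix (Fin n) (Fin n) ℝ} (hZ : Z.PosSemidef)
    (hA : ∀ u : Fin n → ℝ, 0 ≤ u ⬝ᵥ Z *ᵥ (Aᵀ *ᵥ u)) :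
    IsAntistableOn A (LinearMap.range Z.mulVecLin) := by
  rintro _ ⟨u, rfl⟩ _ ⟨w, rfl⟩ a b hne hx hy
  have hsym := dotProduct_mulVec_comm_of_transpose_eq (transpose_eq_of_posSemidef hZ)
  have hA' : ∀ u : Fin n → ℝ, 0 ≤ u ⬝ᵥ A *ᵥ (Z *ᵥ u) := fun u => by
    have := hA u
    rw [hsym, dotProduct_comm, dotProduct_mulVec, vecMul_transpose, dotProduct_comm] at this
    rwa [dotProduct_mulVec, ← mulVec_transpose, dotProduct_comm, dotProduct_comm,
      mulVec_transpose, ← dotProduct_mulVec]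
  simp only [mulVecLin_apply] at hne hx hy
  have hu := hA' u
  have hw := hA' w
  rw [hx] at hu
  rw [hy] at hw
  simp only [dotProduct_sub, dotProduct_add, dotProduct_smul, smul_eq_mul] at hu hw
  have hpos : ∀ z : Fin n → ℝ, 0 ≤ z ⬝ᵥ Z *ᵥ z := fun z => by
    simpa using hZ.dotProduct_mulVec_nonneg z
  have hpos' : ∀ z : Fin n → ℝ, Z *ᵥ z ≠ 0 → 0 < z ⬝ᵥ Z *ᵥ z := fun z hz =>
    (hpos z).lt_of_ne fun h => hz ((hZ.dotProduct_mulVec_zero_iff z).1 (by simpa using h.symm))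
  have hsum : 0 < u ⬝ᵥ Z *ᵥ u + w ⬝ᵥ Z *ᵥ w := by
    rcases hne with h | h
    · linarith [hpos' u h, hpos w]
    · linarith [hpos' w h, hpos u]
  rw [hsym w u] at hw
  by_contra! h0
  nlinarith [mul_pos_of_neg_of_neg h0 (neg_neg_of_pos hsum)]

/-- A vector orthogonal to the kernel of a symmetric matrix lies in its range. -/
theorem mem_range_of_orthogonal_ker {n : ℕ} {Z : Matrix (Fin n) (Fin n) ℝ} (hZ : Zᵀ = Z)
    {x : Fin n → ℝ} (hx : ∀ k, Z *ᵥ k = 0 → x ⬝ᵥ k = 0) : x ∈ LinearMap.range Z.mulVecLin := by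
  have h1 : dotProductEquiv ℝ (Fin n) x ∈ LinearMap.range Z.mulVecLin.dualMap := by
    rw [LinearMap.range_dualMap_eq_dualAnnihilator_ker, Submodule.mem_dualAnnihilator]
    intro k hk
    simpa using hx k (by simpa using hk)
  obtain ⟨g, hg⟩ := h1
  obtain ⟨w, rfl⟩ := (dotProductEquiv ℝ (Fin n)).surjective g
  refine ⟨w, (dotProductEquiv ℝ (Fin n)).injective ?_⟩
  rw [← hg]
  refine LinearMap.ext fun k => ?_
  change (Z *ᵥ w) ⬝ᵥ k = w ⬝ᵥ Z *ᵥ k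
  rw [dotProduct_mulVec, ← mulVec_transpose, hZ]

theorem eq_zero_of_forall_nonneg_linear_add_sq {b c : ℝ} (h : ∀ t : ℝ, 0 ≤ t * b + t ^ 2 * c) :
    b = 0 := by
  have hd := discrim_le_zero (a := c) (b := b) (c := 0) fun t => by linarith [h t]
  simp only [discrim, mul_zero, sub_zero] at hd
  exact pow_eq_zero_iff two_ne_zero |>.1 (le_antisymm hd (sq_nonneg b))

theorem mulVec_mem_range {n : ℕ} {A Z : Matrix (Fin n) (Fin n) ℝ} (hZ : Zᵀ = Z)
    (hA : ∀ u : Fin n → ℝ, 0 ≤ u ⬝ᵥ Z *ᵥ (Aᵀ *ᵥ u)) {x : Fin n → ℝ}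
    (hx : x ∈ LinearMap.range Z.mulVecLin) : A *ᵥ x ∈ LinearMap.range Z.mulVecLin := by
  obtain ⟨w, rfl⟩ := hx
  have hsym := dotProduct_mulVec_comm_of_transpose_eq hZ
  refine mem_range_of_orthogonal_ker hZ fun k hk => ?_
  have key : w ⬝ᵥ Z *ᵥ (Aᵀ *ᵥ k) = 0 := by
    refine eq_zero_of_forall_nonneg_linear_add_sq (c := w ⬝ᵥ Z *ᵥ (Aᵀ *ᵥ w)) fun t => ?_
    have h1 := hA (k + t • w)
    have h2 : ∀ z, k ⬝ᵥ Z *ᵥ z = 0 := fun z => by rw [hsym, hk, dotProduct_zero]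
    simp only [mulVec_add, mulVec_smul, dotProduct_add, add_dotProduct, smul_dotProduct,
      dotProduct_smul, h2, smul_eq_mul] at h1
    linarith
  rw [dotProduct_mulVec, ← mulVec_transpose, hZ, dotProduct_mulVec, vecMul_transpose] at key
  simpa using key

/-- Vectors with real and imaginary parts in a real subspace. -/
def complexify {n : ℕ} (V : Submodule ℝ (Fin n → ℝ)) : Submodule ℂ (Fin n → ℂ) where
  carrier := {v | (fun i => (v i).re) ∈ V ∧ (fun i => (v i).im) ∈ V}
  zero_mem' := ⟨V.zero_mem, V.zero_mem⟩
  add_mem' hv hw := ⟨V.add_mem hv.1 hw.1, V.add_mem hv.2 hw.2⟩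
  smul_mem' c v hv := by
    refine ⟨?_, ?_⟩
    · convert V.sub_mem (V.smul_mem c.re hv.1) (V.smul_mem c.im hv.2) using 1
      ext i; simp
    · convert V.add_mem (V.smul_mem c.re hv.2) (V.smul_mem c.im hv.1) using 1
      ext i; simp

theorem map_mulVec_eq_zero_of_mem_complexify {m n : ℕ} {C : Matrix (Fin m) (Fin n) ℝ}
    {V : Submodule ℝ (Fin n → ℝ)} (hC : ∀ x ∈ V, C *ᵥ x = 0) {v : Fin n → ℂ}
    (hv : v ∈ complexify V) : C.map Complex.ofReal *ᵥ v = 0 := by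
  ext i
  refine Complex.ext ?_ ?_
  · simpa [hC _ hv.1] using congrFun (re_map_mulVec C v) i
  · simpa [hC _ hv.2] using congrFun (im_map_mulVec C v) i

theorem map_mulVec_mem_complexify {n : ℕ} {A : Matrix (Fin n) (Fin n) ℝ}
    {V : Submodule ℝ (Fin n → ℝ)} (hA : ∀ x ∈ V, A *ᵥ x ∈ V) {v : Fin n → ℂ}
    (hv : v ∈ complexify V) : A.map Complex.ofReal *ᵥ v ∈ complexify V :=
  ⟨by rw [re_map_mulVec]; exact hA _ hv.1, by rw [im_map_mulVec]; exact hA _ hv.2⟩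

/-- A nonzero generalized eigenvector in an invariant subspace yields an eigenvector there. -/
theorem exists_eigenvector_mem {E : Type*} [AddCommGroup E] [Module ℂ E] {f : Module.End ℂ E}
    {W : Submodule ℂ E} (hW : ∀ v ∈ W, f v ∈ W) {μ : ℂ} {k : ℕ} {v : E} (hv : v ∈ W)
    (hv0 : v ≠ 0) (hk : ((f - μ • 1) ^ k) v = 0) : ∃ w ∈ W, w ≠ 0 ∧ f w = μ • w := by
  induction k generalizing v with
  | zero => exact absurd (by simpa using hk) hv0
  | succ k ih =>
    by_cases h : (f - μ • 1) v = 0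
    · exact ⟨v, hv, hv0, by simpa [sub_eq_zero] using h⟩
    · refine ih (v := (f - μ • 1) v) ?_ h ?_
      · simpa using W.sub_mem (hW v hv) (W.smul_mem μ hv)
      · rwa [pow_succ, Module.End.mul_apply] at hk

/-- An invariant subspace of `ker C` on which `A` is antistable is killed by `K`. -/
theorem mulVec_eq_zero_of_isAntistableOn {n p r : ℕ} {A : Matrix (Fin n) (Fin n) ℝ}
    {C : Matrix (Fin p) (Fin n) ℝ} {K : Matrix (Fin r) (Fin n) ℝ}
    (hdet : ∀ lam : ℂ, 0 ≤ lam.re → ∀ v : Fin n → ℂ,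
      (∀ j : ℕ, j < n →
        ((C.map Complex.ofReal) *
          (lam • (1 : Matrix (Fin n) (Fin n) ℂ) - A.map Complex.ofReal) ^ j).mulVec v = 0) →
      ((lam • (1 : Matrix (Fin n) (Fin n) ℂ) - A.map Complex.ofReal) ^ n).mulVec v = 0 →
      (K.map Complex.ofReal).mulVec v = 0)
    {V : Submodule ℝ (Fin n → ℝ)} (hA : ∀ x ∈ V, A *ᵥ x ∈ V) (hC : ∀ x ∈ V, C *ᵥ x = 0)
    (hV : IsAntistableOn A V) : ∀ x ∈ V, K *ᵥ x = 0 := by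
  set Ac := A.map Complex.ofReal with hAc
  set f : Module.End ℂ (Fin n → ℂ) := toLin' Ac with hf
  have hW : ∀ v ∈ complexify V, f v ∈ complexify V := fun v hv => by
    simpa [hf] using map_mulVec_mem_complexify hA hv
  have hpow : ∀ (μ : ℂ) (k : ℕ), ∀ v ∈ complexify V,
      (μ • (1 : Matrix (Fin n) (Fin n) ℂ) - Ac) ^ k *ᵥ v ∈ complexify V := by
    intro μ k
    induction k with
    | zero => intro v hv; simpa using hv
    | succ k ih =>
      intro v hv
      rw [pow_succ, ← mulVec_mulVec]
      refine ih _ ?_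
      rw [sub_mulVec, smul_mulVec, one_mulVec]
      exact Submodule.sub_mem _ (Submodule.smul_mem _ _ hv) (map_mulVec_mem_complexify hA hv)
  have hle : complexify V ≤ LinearMap.ker (toLin' (K.map Complex.ofReal)) := by
    have htop : ⨆ μ : ℂ, f.genEigenspace μ (n : ℕ∞) = ⊤ := by
      rw [← Module.End.iSup_maxGenEigenspace_eq_top f]
      refine iSup_congr fun μ => ?_
      rw [Module.End.maxGenEigenspace_eq_genEigenspace_finrank]
      simp
    have heq : complexify V = ⨆ μ, complexify V ⊓ f.genEigenspace μ (n : ℕ∞) := by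
      rw [← Submodule.inf_iSup_genEigenspace hW, htop, inf_top_eq]
    rw [heq]
    refine iSup_le fun μ v hv => ?_
    rcases eq_or_ne v 0 with rfl | hv0
    · simp
    have hvn := Module.End.mem_genEigenspace_nat.1 hv.2
    rw [LinearMap.mem_ker] at hvn
    obtain ⟨w, hwV, hw0, hw⟩ := exists_eigenvector_mem hW hv.1 hv0 hvn
    have hwA : Ac *ᵥ w = μ • w := by simpa [hf] using hw
    obtain ⟨hre, him⟩ := re_im_eq_of_map_mulVec_eq_smul hwA
    have hμ := hV _ hwV.1 _ hwV.2 _ _ (re_ne_zero_or_im_ne_zero hw0) hre him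
    rw [LinearMap.mem_ker, toLin'_apply]
    refine hdet μ hμ v (fun j _ => ?_) ?_
    · rw [← mulVec_mulVec]
      exact map_mulVec_eq_zero_of_mem_complexify hC (hpow μ j v hv.1)
    · have h1 : f - μ • 1 = toLin' (-(μ • (1 : Matrix (Fin n) (Fin n) ℂ) - Ac)) := by
        simp [hf, map_sub, toLin'_one]; rfl
      rw [h1, ← toLin'_pow, toLin'_apply, neg_pow, ← mulVec_mulVec] at hvn
      rcases neg_one_pow_eq_or (Matrix (Fin n) (Fin n) ℂ) n with h | h <;> rw [h] at hvn
      · simpa using hvn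
      · simpa [neg_mulVec] using hvn
  intro x hx
  have hxc : (fun i => (x i : ℂ)) ∈ complexify V := ⟨by simpa using hx, V.zero_mem⟩
  have h1 := hle hxc
  rw [LinearMap.mem_ker, toLin'_apply] at h1
  have h2 := re_map_mulVec K fun i => (x i : ℂ)
  rw [h1] at h2
  exact h2.symm

/-- Every subspace is the kernel of a matrix with orthonormal rows. -/
theorem exists_orthonormal_rows_ker_eq {n : ℕ} (V : Submodule ℝ (Fin n → ℝ)) :
    ∃ (q : ℕ) (T : Matrix (Fin q) (Fin n) ℝ), T * Tᵀ = 1 ∧ ∀ x, T *ᵥ x = 0 ↔ x ∈ V := by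
  let W : Submodule ℝ (EuclideanSpace ℝ (Fin n)) :=
    V.comap (WithLp.linearEquiv 2 ℝ (Fin n → ℝ)).toLinearMap
  let b := stdOrthonormalBasis ℝ Wᗮ
  refine ⟨_, Matrix.of fun i j => (b i : EuclideanSpace ℝ (Fin n)) j, ?_, fun x => ?_⟩
  · ext i j
    have := orthonormal_iff_ite.1 b.orthonormal j i
    rw [Submodule.coe_inner] at this
    simpa [mul_apply, one_apply, PiLp.inner_apply, eq_comm] using this
  · have h1 : x ∈ V ↔ WithLp.toLp 2 x ∈ Wᗮᗮ := by
      rw [Submodule.orthogonal_orthogonal]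
      rfl
    have hinner : ∀ i, ((Matrix.of fun i j => (b i : EuclideanSpace ℝ (Fin n)) j) *ᵥ x) i =
        inner ℝ (b i : EuclideanSpace ℝ (Fin n)) (WithLp.toLp 2 x) := fun i => by
      simp [mulVec, dotProduct, PiLp.inner_apply, mul_comm]
    rw [h1]
    constructor
    · intro h
      rw [Submodule.mem_orthogonal]
      intro u hu
      have h2 := b.sum_repr ⟨u, hu⟩
      have h3 : u = ∑ i, b.repr ⟨u, hu⟩ i • (b i : EuclideanSpace ℝ (Fin n)) := by
        simpa using (congrArg Subtype.val h2).symm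
      rw [h3, sum_inner]
      refine Finset.sum_eq_zero fun i _ => ?_
      rw [inner_smul_left, ← hinner, h]
      simp
    · intro h
      ext i
      rw [hinner]
      exact (Submodule.mem_orthogonal _ _).1 h _ (b i).2

theorem mul_transpose_mul_self_eq {m n q : ℕ} {T : Matrix (Fin q) (Fin n) ℝ} (hT : T * Tᵀ = 1)
    {M : Matrix (Fin m) (Fin n) ℝ} (hM : ∀ x, T *ᵥ x = 0 → M *ᵥ x = 0) : M * Tᵀ * T = M := by
  refine ext_of_mulVec_single fun j => ?_
  have h := hM (Tᵀ *ᵥ (T *ᵥ Pi.single j 1) - Pi.single j 1) (by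
    rw [mulVec_sub, mulVec_mulVec, hT, one_mulVec, sub_self])
  rwa [mulVec_sub, sub_eq_zero, mulVec_mulVec, mulVec_mulVec] at h

/-- If `A` is antistable on a subspace containing `ker T` and induces `A'` through `T`, then the
preimage under `T` of a subspace on which `A'` is antistable is again antistable for `A`. -/
theorem isAntistableOn_comap {n q : ℕ} {A : Matrix (Fin n) (Fin n) ℝ}
    {A' : Matrix (Fin q) (Fin q) ℝ} {T : Matrix (Fin q) (Fin n) ℝ} (hT : T * A = A' * T)
    {V : Submodule ℝ (Fin n → ℝ)} (hV : ∀ x, T *ᵥ x = 0 → x ∈ V) (hA : IsAntistableOn A V)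
    {R : Submodule ℝ (Fin q → ℝ)} (hR : IsAntistableOn A' R) :
    IsAntistableOn A (R.comap T.mulVecLin) := by
  intro x hx y hy a b hne hAx hAy
  by_cases h : T *ᵥ x = 0 ∧ T *ᵥ y = 0
  · exact hA x (hV x h.1) y (hV y h.2) a b hne hAx hAy
  · refine hR (T *ᵥ x) hx (T *ᵥ y) hy a b (by tauto) ?_ ?_
    · rw [mulVec_mulVec, ← hT, ← mulVec_mulVec, hAx, mulVec_sub, mulVec_smul, mulVec_smul]
    · rw [mulVec_mulVec, ← hT, ← mulVec_mulVec, hAy, mulVec_add, mulVec_smul, mulVec_smul]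

/-- **Lemma 3 of the paper.** If `(A, C)` is partially detectable with
respect to `K` (kernel form of the rank condition), then there exist `q`, `T ∈ ℝ^{q×n}`
and `L ∈ ℝ^{q×p}` such that `N := (TA − LC)Tᵀ` is Hurwitz, `NT + LC = TA` and
`KTᵀT = K`. -/
theorem stmt_8 (n p r : ℕ) (A : Matrix (Fin n) (Fin n) ℝ) (C : Matrix (Fin p) (Fin n) ℝ)
    (K : Matrix (Fin r) (Fin n) ℝ)
    (hdet : ∀ lam : ℂ, 0 ≤ lam.re → ∀ v : Fin n → ℂ,
      (∀ j : ℕ, j < n →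
        ((C.map Complex.ofReal) *
          (lam • (1 : Matrix (Fin n) (Fin n) ℂ) - A.map Complex.ofReal) ^ j).mulVec v = 0) →
      ((lam • (1 : Matrix (Fin n) (Fin n) ℂ) - A.map Complex.ofReal) ^ n).mulVec v = 0 →
      (K.map Complex.ofReal).mulVec v = 0) :
    ∃ (q : ℕ) (T : Matrix (Fin q) (Fin n) ℝ) (L : Matrix (Fin q) (Fin p) ℝ),
      (∀ μ ∈ spectrum ℂ (((T * A - L * C) * Tᵀ).map Complex.ofReal), μ.re < 0) ∧
      ((T * A - L * C) * Tᵀ) * T + L * C = T * A ∧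
      K * Tᵀ * T = K := by
  let P : Submodule ℝ (Fin n → ℝ) → Prop := fun V =>
    (∀ x ∈ V, A *ᵥ x ∈ V) ∧ (∀ x ∈ V, C *ᵥ x = 0) ∧ IsAntistableOn A V
  have hbot : P ⊥ := by
    refine ⟨by simp, by simp, fun x hx y hy a b hne _ _ => ?_⟩
    rw [Submodule.mem_bot] at hx hy
    simp [hx, hy] at hne
  obtain ⟨V, ⟨hVA, hVC, hVs⟩, hmax⟩ :=
    (wellFounded_gt (α := Submodule ℝ (Fin n → ℝ))).has_min {V | P V} ⟨⊥, hbot⟩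
  obtain ⟨q, T, hT, hker⟩ := exists_orthonormal_rows_ker_eq V
  have hKT : K * Tᵀ * T = K := mul_transpose_mul_self_eq hT fun x hx =>
    mulVec_eq_zero_of_isAntistableOn hdet hVA hVC hVs x ((hker x).1 hx)
  have hCT : C * Tᵀ * T = C := mul_transpose_mul_self_eq hT fun x hx => hVC x ((hker x).1 hx)
  have hAT : T * A * Tᵀ * T = T * A := mul_transpose_mul_self_eq hT fun x hx => by
    rw [← mulVec_mulVec]
    exact (hker _).2 (hVA x ((hker x).1 hx))
  rcases exists_lyapunov_certificate_or_dual (T * A * Tᵀ) (C * Tᵀ) with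
    ⟨X, γ, hX, hneg⟩ | ⟨Z, hZ, hZ0, hZA, hZC⟩
  · refine ⟨q, T, γ • (X⁻¹ * (C * Tᵀ)ᵀ), re_neg_of_mem_spectrum_of_lyapunov hX ?_, ?_, hKT⟩
    · convert hneg using 1
      have hXu : IsUnit X.det := (isUnit_iff_isUnit_det _).1 hX.isUnit
      rw [Matrix.sub_mul, Matrix.mul_sub, Matrix.smul_mul, Matrix.smul_mul, Matrix.mul_smul,
        Matrix.mul_assoc X⁻¹, Matrix.mul_assoc X⁻¹, mul_nonsing_inv_cancel_left _ _ hXu,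
        Matrix.mul_assoc _ C]
    · set L := γ • (X⁻¹ * (C * Tᵀ)ᵀ)
      rw [Matrix.sub_mul, Matrix.sub_mul, hAT, Matrix.mul_assoc L, Matrix.mul_assoc L, hCT, sub_add_cancel]
  · exfalso
    let R := LinearMap.range Z.mulVecLin
    have hP : P (R.comap T.mulVecLin) := by
      refine ⟨fun x hx => ?_, fun x hx => ?_, isAntistableOn_comap hAT.symm
        (fun x hx => (hker x).1 hx) hVs (isAntistableOn_range hZ hZA)⟩
      · have h := mulVec_mem_range (transpose_eq_of_posSemidef hZ) hZA hx
        rw [mulVecLin_apply, mulVec_mulVec, hAT, ← mulVec_mulVec] at h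
        exact h
      · obtain ⟨w, hw⟩ := hx
        simp only [mulVecLin_apply] at hw
        rw [← hCT, ← mulVec_mulVec, ← hw, mulVec_mulVec, hZC, zero_mulVec]
    have hle : V ≤ R.comap T.mulVecLin := fun x hx => by
      rw [Submodule.mem_comap, mulVecLin_apply, (hker x).2 hx]
      exact R.zero_mem
    have heq : V = R.comap T.mulVecLin := hle.eq_of_not_lt (hmax _ hP)
    refine hZ0 (ext_of_mulVec_single fun j => ?_)
    have hTT : ∀ z, T *ᵥ (Tᵀ *ᵥ z) = z := fun z => by rw [mulVec_mulVec, hT, one_mulVec]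
    have hmem : Tᵀ *ᵥ (Z *ᵥ Pi.single j 1) ∈ V := by
      rw [heq, Submodule.mem_comap, mulVecLin_apply, hTT]
      exact ⟨_, rfl⟩
    rw [← hTT (Z *ᵥ Pi.single j 1), (hker _).2 hmem, zero_mulVec]
end

section
/- (Theorem 2 of the paper.) Let A ∈ ℝ^{n×n}, B ∈ ℝ^{n×m}, C ∈ ℝ^{p×n}, D ∈ ℝ^{p×m}, K ∈ ℝ^{r×n}, and assume the pair (A, C) is partially detectable with respect to K (rank-condition form: for every λ ∈ ℂ with Re λ ≥ 0, every v ∈ ℂⁿ with C(λI−A)^j v = 0 for all j = 0,…,n−1 and (λI−A)^n v = 0 satisfies Kv = 0). Then there exist a nonnegative integer q and matrices N ∈ ℝ^{q×q}, H ∈ ℝ^{q×m}, L ∈ ℝ^{q×p}, R ∈ ℝ^{r×q} such that for every continuous u : ℝ → ℝ^m and all differentiable x : ℝ → ℝⁿ and w : ℝ → ℝ^q satisfying, for all t ≥ 0, x'(t) = A x(t) + B u(t) and w'(t) = N w(t) + H u(t) + L (C x(t) + D u(t)), one has R w(t) − K x(t) → 0 as t → ∞. -/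
open Filter Topology

/-- A curve solving a stable scalar equation with vanishing forcing tends to zero. -/
theorem tendsto_zero_of_hasDerivAt_smul_add {E : Type*} [NormedAddCommGroup E] [NormedSpace ℂ E]
    {lam : ℂ} (hlam : lam.re < 0) {c g : ℝ → E}
    (hc : ∀ t, 0 ≤ t → HasDerivAt c (lam • c t + g t) t) (hg : Tendsto g atTop (𝓝 0)) :
    Tendsto c atTop (𝓝 0) := by
  obtain ⟨a, ha⟩ : ∃ a, a = -lam.re := ⟨_, rfl⟩
  have ha0 : 0 < a := by linarith
  have hexp : ∀ t : ℝ, HasDerivAt (fun t : ℝ => Complex.exp (-lam * t))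
      (Complex.exp (-lam * t) * -lam) t := fun t => by
    have h1 : HasDerivAt (fun s : ℂ => Complex.exp (-lam * s))
        (Complex.exp (-lam * t) * -lam) (t : ℂ) := by
      simpa using ((hasDerivAt_id (t : ℂ)).const_mul (-lam)).cexp
    exact h1.comp_ofReal
  have hnorm : ∀ t : ℝ, ‖Complex.exp (-lam * t)‖ = Real.exp (a * t) := fun t => by
    rw [Complex.norm_exp]; simp [ha]
  have hh : ∀ t : ℝ, 0 ≤ t → HasDerivAt (fun t : ℝ => Complex.exp (-lam * t) • c t)
      (Complex.exp (-lam * t) • g t) t := fun t ht => by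
    refine ((hexp t).smul (hc t ht)).congr_deriv ?_
    rw [smul_add, smul_smul, mul_neg, neg_smul]
    abel
  rw [NormedAddGroup.tendsto_nhds_zero]
  intro ε hε
  obtain ⟨T₀, hT₀⟩ := eventually_atTop.1
    (NormedAddGroup.tendsto_nhds_zero.1 hg (ε * a / 2) (by positivity))
  obtain ⟨T, hT⟩ : ∃ T, T = max T₀ 0 := ⟨_, rfl⟩
  have hT0 : 0 ≤ T := hT ▸ le_max_right _ _
  have hTT : T₀ ≤ T := hT ▸ le_max_left _ _
  obtain ⟨M, hM⟩ : ∃ M, M = ‖Complex.exp (-lam * T) • c T‖ := ⟨_, rfl⟩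
  have key : ∀ t : ℝ, T ≤ t → Real.exp (a * t) * ‖c t‖ ≤
      M + ε / 2 * (Real.exp (a * t) - Real.exp (a * T)) := by
    intro t ht
    have hb := image_norm_le_of_norm_deriv_right_le_deriv_boundary (a := T) (b := t)
      (f := fun t : ℝ => Complex.exp (-lam * t) • c t)
      (f' := fun t : ℝ => Complex.exp (-lam * t) • g t)
      (B := fun t => M + ε / 2 * (Real.exp (a * t) - Real.exp (a * T)))
      (B' := fun t => ε / 2 * (Real.exp (a * t) * a))
      (fun s hs => (hh s (hT0.trans hs.1)).continuousAt.continuousWithinAt)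
      (fun s hs => (hh s (hT0.trans hs.1)).hasDerivWithinAt)
      (by simp [hM])
      (fun s => by
        have h1 : HasDerivAt (fun t : ℝ => Real.exp (a * t)) (Real.exp (a * s) * a) s := by
          simpa using ((hasDerivAt_id s).const_mul a).exp
        simpa using ((h1.sub_const (Real.exp (a * T))).const_mul (ε / 2)).const_add M)
      (fun s hs => by
        have h1 := (hT₀ s (hTT.trans hs.1)).le
        have h2 := mul_le_mul_of_nonneg_left h1 (Real.exp_pos (a * s)).le
        rw [norm_smul, hnorm]
        linarith)
      (Set.right_mem_Icc.2 ht)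
    simpa only [norm_smul, hnorm] using hb
  have hlim : Tendsto (fun t : ℝ => M * Real.exp (-(a * t))) atTop (𝓝 0) := by
    have := (Real.tendsto_exp_neg_atTop_nhds_zero.comp
      (tendsto_id.const_mul_atTop ha0)).const_mul M
    simpa [Function.comp_def] using this
  filter_upwards [eventually_ge_atTop T, hlim.eventually_lt_const (half_pos hε)] with t ht hMt
  have h1 := mul_le_mul_of_nonneg_left (key t ht) (Real.exp_pos (-(a * t))).le
  have h2 : Real.exp (-(a * t)) * Real.exp (a * t) = 1 := by
    rw [← Real.exp_add]; simp
  have h3 : 0 ≤ Real.exp (-(a * t)) * (ε / 2 * Real.exp (a * T)) := by positivity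
  have h4 : ‖c t‖ = Real.exp (-(a * t)) * (Real.exp (a * t) * ‖c t‖) := by
    rw [← mul_assoc, h2, one_mul]
  have h5 : Real.exp (-(a * t)) * (M + ε / 2 * (Real.exp (a * t) - Real.exp (a * T))) =
      M * Real.exp (-(a * t)) + ε / 2 * (Real.exp (-(a * t)) * Real.exp (a * t))
        - Real.exp (-(a * t)) * (ε / 2 * Real.exp (a * T)) := by ring
  rw [h2] at h5
  linarith

theorem LinearMap.exists_eq_comp_of_ker_le {𝕜 X F G : Type*} [Field 𝕜] [AddCommGroup X]
    [Module 𝕜 X] [AddCommGroup F] [Module 𝕜 F] [AddCommGroup G] [Module 𝕜 G]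
    (f : X →ₗ[𝕜] F) (g : X →ₗ[𝕜] G)
    (h : LinearMap.ker f ≤ LinearMap.ker g) : ∃ l : F →ₗ[𝕜] G, ∀ v, g v = l (f v) := by
  obtain ⟨s, hs⟩ := ((LinearMap.ker f).liftQ f le_rfl).exists_leftInverse_of_injective
    (Submodule.ker_liftQ_eq_bot _ _ _ le_rfl)
  refine ⟨(LinearMap.ker f).liftQ g h ∘ₗ s, fun v => ?_⟩
  have := LinearMap.congr_fun hs ((LinearMap.ker f).mkQ v)
  simp only [LinearMap.comp_apply, Submodule.mkQ_apply, Submodule.liftQ_apply,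
    LinearMap.id_apply] at this
  simp [this]

section Estimable

variable {X Y E : Type} [AddCommGroup X] [Module ℂ X] [AddCommGroup Y] [Module ℂ Y]
  [NormedAddCommGroup E] [NormedSpace ℂ E]

/-- `k` is estimable from the output `C` of the system `A` if there are a stable `N` and maps
`T, L, R` with `T A = N T + L C` and `R T = k` (the Luenberger equations). -/
def Estimable (A : Module.End ℂ X) (C : X →ₗ[ℂ] Y) (k : X →ₗ[ℂ] E) : Prop :=
  ∃ (V : Type) (_ : NormedAddCommGroup V) (_ : NormedSpace ℂ V) (_ : FiniteDimensional ℂ V)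
    (N : Module.End ℂ V) (T : X →ₗ[ℂ] V) (L : Y →ₗ[ℂ] V) (R : V →ₗ[ℂ] E),
    (∀ v, T (A v) = N (T v) + L (C v)) ∧ (∀ v, R (T v) = k v) ∧
    ∀ e : ℝ → V, (∀ t, 0 ≤ t → HasDerivAt e (N (e t)) t) → Tendsto e atTop (𝓝 0)

variable {A : Module.End ℂ X} {C : X →ₗ[ℂ] Y}

theorem Estimable.zero : Estimable A C (0 : X →ₗ[ℂ] E) :=
  ⟨PUnit, inferInstance, inferInstance, inferInstance, 0, 0, 0, 0, fun _ => rfl, fun _ => rfl,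
    fun _ _ => tendsto_const_nhds⟩

variable [FiniteDimensional ℂ E]

theorem Estimable.cascade {k k' : X →ₗ[ℂ] E} {lam : ℂ} (hlam : lam.re < 0) (f : Y →ₗ[ℂ] E)
    (hk' : Estimable A C k') (h : ∀ v, k (A v) = lam • k v + k' v + f (C v)) :
    Estimable A C k := by
  obtain ⟨V, _, _, _, N, T, L, R, hT, hR, hN⟩ := hk'
  refine ⟨V × E, inferInstance, inferInstance, inferInstance,
    (N ∘ₗ LinearMap.fst ℂ V E).prod (lam • LinearMap.snd ℂ V E + R ∘ₗ LinearMap.fst ℂ V E),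
    T.prod k, L.prod f, LinearMap.snd ℂ V E, fun v => ?_, fun v => rfl, fun e he => ?_⟩
  · ext <;> simp [hT, hR, h]
  · have h1 : Tendsto (fun t => (e t).1) atTop (𝓝 0) :=
      hN _ fun t ht => (ContinuousLinearMap.fst ℝ V E).hasFDerivAt.comp_hasDerivAt t (he t ht)
    have h2 : Tendsto (fun t => (e t).2) atTop (𝓝 0) := by
      refine tendsto_zero_of_hasDerivAt_smul_add hlam (g := fun t => R (e t).1) (fun t ht =>
        (ContinuousLinearMap.snd ℝ V E).hasFDerivAt.comp_hasDerivAt t (he t ht)) ?_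
      have := (R.continuous_of_finiteDimensional.tendsto 0).comp h1
      simpa [Function.comp_def] using this
    exact h1.prodMk_nhds h2

theorem Estimable.of_comp_sub_pow {lam : ℂ} (hlam : lam.re < 0) (m : ℕ) :
    ∀ {k : X →ₗ[ℂ] E}, Estimable A C (k ∘ₗ ((A - lam • 1) ^ m : Module.End ℂ X)) →
      Estimable A C k := by
  induction m with
  | zero => intro k hk; simpa [Module.End.one_eq_id] using hk
  | succ m ih =>
    intro k hk
    refine Estimable.cascade hlam 0
      (ih (k := k ∘ₗ (A - lam • 1 : Module.End ℂ X)) ?_) (fun v => by simp)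
    rwa [pow_succ'] at hk

theorem Estimable.of_comp_prod (m : ℕ) (s : Multiset ℂ) (hs : ∀ lam ∈ s, lam.re < 0) :
    ∀ {k : X →ₗ[ℂ] E}, Estimable A C (k ∘ₗ (Polynomial.aeval A
      (s.map fun lam => (Polynomial.X - Polynomial.C lam) ^ m).prod)) → Estimable A C k := by
  induction s using Multiset.induction_on with
  | empty => intro k hk; simpa [Module.End.one_eq_id] using hk
  | cons lam s ih =>
    intro k hk
    refine Estimable.of_comp_sub_pow (hs lam (by simp)) m
      (ih (fun μ hμ => hs μ (by simp [hμ])) ?_)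
    simpa [Module.End.mul_eq_comp, LinearMap.comp_assoc, Algebra.algebraMap_eq_smul_one] using hk

theorem Estimable.of_comp_pow_eq_sum (N : ℕ) : ∀ {k : X →ₗ[ℂ] E} (f : ℕ → Y →ₗ[ℂ] E),
    (∀ v, k (((A + 1) ^ N : Module.End ℂ X) v) =
      ∑ j ∈ Finset.range N, f j (C (((A + 1) ^ j : Module.End ℂ X) v))) →
      Estimable A C k := by
  induction N with
  | zero =>
    intro k f h
    have : k = 0 := by ext v; simpa using h v
    exact this ▸ Estimable.zero
  | succ N ih =>
    intro k f h
    refine Estimable.cascade (lam := -1) (by simp) (f N)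
      (ih (k := k ∘ₗ (A + 1 : Module.End ℂ X) - f N ∘ₗ C) f fun v => ?_) (fun v => ?_)
    · have := h v
      rw [Finset.sum_range_succ, pow_succ'] at this
      simp only [LinearMap.sub_apply, LinearMap.comp_apply]
      rw [sub_eq_iff_eq_add, ← this]
      rfl
    · simp only [LinearMap.sub_apply, LinearMap.comp_apply, LinearMap.add_apply,
        Module.End.one_apply, map_add, neg_smul, one_smul]
      abel

variable [FiniteDimensional ℂ X]

/-- A functional vanishing on the unobservable subspace is estimable. -/
theorem Estimable.of_vanish_unobservable {k : X →ₗ[ℂ] E}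
    (h : ∀ v, (∀ j : ℕ, C (((A + 1) ^ j : Module.End ℂ X) v) = 0) → k v = 0) :
    Estimable A C k := by
  let U : ℕ → Submodule ℂ X := fun N =>
    ⨅ j ∈ Finset.range N, LinearMap.ker (C ∘ₗ ((A + 1) ^ j : Module.End ℂ X))
  have hU : ∀ M v, v ∈ U M ↔ ∀ j < M, C (((A + 1) ^ j : Module.End ℂ X) v) = 0 :=
    fun M v => by simp [U, Submodule.mem_iInf]
  have hanti : Antitone U := fun a b hab v hv =>
    (hU a v).2 fun j hj => (hU b v).1 hv j (hj.trans_le hab)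
  obtain ⟨N, hN⟩ := IsArtinian.monotone_stabilizes
    (⟨fun N => OrderDual.toDual (U N), fun _ _ h => hanti h⟩ : ℕ →o (Submodule ℂ X)ᵒᵈ)
  have hstab : ∀ v, (∀ j < N, C (((A + 1) ^ j : Module.End ℂ X) v) = 0) →
      ∀ j, C (((A + 1) ^ j : Module.End ℂ X) v) = 0 := fun v hv j => by
    have h1 := (hU N v).2 hv
    rw [show U N = U (max N (j + 1)) from hN _ (le_max_left _ _)] at h1
    exact (hU _ v).1 h1 j (by omega)
  obtain ⟨l, hl⟩ := LinearMap.exists_eq_comp_of_ker_le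
    (LinearMap.pi fun j : Fin N => C ∘ₗ ((A + 1) ^ (j : ℕ) : Module.End ℂ X))
    (k ∘ₗ ((A + 1) ^ N : Module.End ℂ X)) (fun v hv => by
      refine h _ fun j => ?_
      rw [← Module.End.mul_apply, ← pow_add]
      exact hstab v (fun i hi => congr_fun (LinearMap.mem_ker.1 hv) ⟨i, hi⟩) _)
  refine Estimable.of_comp_pow_eq_sum N
    (fun j => if hj : j < N then l ∘ₗ LinearMap.single ℂ (fun _ : Fin N => Y) ⟨j, hj⟩ else 0)
    fun v => ?_
  rw [Finset.sum_range]
  refine (hl v).trans ?_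
  rw [← LinearMap.sum_single_apply (fun _ : Fin N => Y) (LinearMap.pi _ v), map_sum]
  simp

/-- Partial detectability implies estimability. -/
theorem Estimable.of_detectable {k : X →ₗ[ℂ] E}
    (hdet : ∀ lam : ℂ, 0 ≤ lam.re → ∀ v,
      (∀ j : ℕ, C (((lam • 1 - A) ^ j : Module.End ℂ X) v) = 0) →
      ((lam • 1 - A) ^ Module.finrank ℂ X : Module.End ℂ X) v = 0 → k v = 0) :
    Estimable A C k := by
  set n := Module.finrank ℂ X with hn
  let U : Submodule ℂ X := ⨅ j : ℕ, LinearMap.ker (C ∘ₗ ((A + 1) ^ j : Module.End ℂ X))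
  have hU : ∀ v, v ∈ U ↔ ∀ j : ℕ, C (((A + 1) ^ j : Module.End ℂ X) v) = 0 := fun v => by
    simp [U, Submodule.mem_iInf]
  have hUA : ∀ v ∈ U, A v ∈ U := fun v hv => by
    have h1 : (A + 1) v ∈ U := (hU _).2 fun j => by
      rw [← Module.End.mul_apply, ← pow_succ]; exact (hU v).1 hv _
    simpa using U.sub_mem h1 hv
  have hUp : ∀ (q : Polynomial ℂ), ∀ v ∈ U, Polynomial.aeval A q v ∈ U := fun q v hv => by
    induction q using Polynomial.induction_on' with
    | add p q hp hq => simpa using U.add_mem hp hq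
    | monomial j a =>
      have : (A ^ j : Module.End ℂ X) v ∈ U := by
        induction j with
        | zero => simpa
        | succ j ih => rw [pow_succ']; exact hUA _ ih
      simpa [Polynomial.aeval_monomial, Module.algebraMap_end_apply] using U.smul_mem a this
  have hC : ∀ v ∈ U, C v = 0 := fun v hv => by simpa using (hU v).1 hv 0
  let s : Multiset ℂ := A.charpoly.roots.filter fun lam => lam.re < 0
  refine Estimable.of_comp_prod n s (fun lam h => (Multiset.mem_filter.1 h).2)
    (Estimable.of_vanish_unobservable fun v hv => ?_)
  set d : Polynomial ℂ := (s.map fun lam => (Polynomial.X - Polynomial.C lam) ^ n).prod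
  have htop : ⨆ μ, A.genEigenspace μ n = ⊤ := by
    rw [← Module.End.iSup_maxGenEigenspace_eq_top A]
    simp_rw [Module.End.maxGenEigenspace_eq_genEigenspace_finrank, hn]
  have hvU : v ∈ ⨆ μ, U ⊓ A.genEigenspace μ n :=
    Submodule.eq_iSup_inf_genEigenspace (n : ℕ∞) hUA htop ▸ (hU v).2 hv
  have hker : ⨆ μ, U ⊓ A.genEigenspace μ n ≤ LinearMap.ker (k ∘ₗ Polynomial.aeval A d) := by
    refine iSup_le fun μ x hx => ?_
    obtain ⟨hxU, hxμ⟩ := Submodule.mem_inf.1 hx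
    rw [LinearMap.mem_ker, LinearMap.comp_apply]
    have hxμ' : ((A - μ • 1) ^ n : Module.End ℂ X) x = 0 :=
      LinearMap.mem_ker.1 (Module.End.mem_genEigenspace_nat.1 hxμ)
    have haeval : Polynomial.aeval A ((Polynomial.X - Polynomial.C μ) ^ n) =
        ((A - μ • 1) ^ n : Module.End ℂ X) := by
      simp [Algebra.algebraMap_eq_smul_one]
    have haeval' : ∀ j : ℕ, Polynomial.aeval A ((Polynomial.C μ - Polynomial.X) ^ j) =
        ((μ • 1 - A) ^ j : Module.End ℂ X) := fun j => by
      simp [Algebra.algebraMap_eq_smul_one]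
    rcases lt_or_ge μ.re 0 with hμ | hμ
    · by_cases hx0 : x = 0
      · simp [hx0]
      have hev : A.HasEigenvalue μ := Module.End.hasEigenvalue_of_hasGenEigenvalue (k := n)
        fun hbot => hx0 (by simpa [hbot] using hxμ)
      have hroot : μ ∈ s := Multiset.mem_filter.2
        ⟨(Polynomial.mem_roots A.charpoly_monic.ne_zero).2
          ((Module.End.hasEigenvalue_iff_isRoot_charpoly A μ).1 hev), hμ⟩
      obtain ⟨q, hq⟩ : (Polynomial.X - Polynomial.C μ) ^ n ∣ d :=
        Multiset.dvd_prod (Multiset.mem_map_of_mem _ hroot)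
      rw [hq, mul_comm, map_mul, haeval, Module.End.mul_apply, hxμ', map_zero, map_zero]
    · refine hdet μ hμ _ (fun j => ?_) ?_
      · rw [← haeval']
        exact hC _ (hUp _ _ (hUp _ _ hxU))
      · rw [← haeval', ← Module.End.mul_apply, ← map_mul, mul_comm, map_mul, haeval',
          Module.End.mul_apply, ← neg_sub, neg_pow, Module.End.mul_apply, hxμ', map_zero, map_zero]
  exact hker hvU

end Estimable

/-- **Theorem 2 of the paper.** If `(A, C)` is partially detectable with
respect to `K`, then there exists a partial state estimator
`w' = Nw + Hu + Ly`, `ẑ = Rw` for the plant `x' = Ax + Bu`, `y = Cx + Du`, `z = Kx`,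
i.e. `Rw(t) − Kx(t) → 0` as `t → ∞` along all solutions. -/
theorem stmt_9 (n m p r : ℕ) (A : Matrix (Fin n) (Fin n) ℝ) (B : Matrix (Fin n) (Fin m) ℝ)
    (C : Matrix (Fin p) (Fin n) ℝ) (D : Matrix (Fin p) (Fin m) ℝ)
    (K : Matrix (Fin r) (Fin n) ℝ)
    (hdet : ∀ lam : ℂ, 0 ≤ lam.re → ∀ v : Fin n → ℂ,
      (∀ j : ℕ, j < n →
        ((C.map Complex.ofReal) *
          (lam • (1 : Matrix (Fin n) (Fin n) ℂ) - A.map Complex.ofReal) ^ j).mulVec v = 0) →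
      ((lam • (1 : Matrix (Fin n) (Fin n) ℂ) - A.map Complex.ofReal) ^ n).mulVec v = 0 →
      (K.map Complex.ofReal).mulVec v = 0) :
    ∃ (q : ℕ) (N : Matrix (Fin q) (Fin q) ℝ) (H : Matrix (Fin q) (Fin m) ℝ)
      (L : Matrix (Fin q) (Fin p) ℝ) (R : Matrix (Fin r) (Fin q) ℝ),
      ∀ u : ℝ → (Fin m → ℝ), Continuous u →
      ∀ x : ℝ → (Fin n → ℝ), Differentiable ℝ x →
      ∀ w : ℝ → (Fin q → ℝ), Differentiable ℝ w →
      (∀ t : ℝ, 0 ≤ t → deriv x t = A.mulVec (x t) + B.mulVec (u t)) →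
      (∀ t : ℝ, 0 ≤ t →
        deriv w t = N.mulVec (w t) + H.mulVec (u t) +
          L.mulVec (C.mulVec (x t) + D.mulVec (u t))) →
      Filter.Tendsto (fun t => R.mulVec (w t) - K.mulVec (x t)) Filter.atTop (nhds 0) := by
  have hcoe : ∀ {a b : ℕ} (M : Matrix (Fin a) (Fin b) ℝ) (v : Fin b → ℝ),
      (M.map Complex.ofReal).mulVec (Complex.ofRealCLM.toLinearMap.compLeft (Fin b) v) =
        Complex.ofRealCLM.toLinearMap.compLeft (Fin a) (M.mulVec v) := fun M v => by
    ext i; simp [Matrix.mulVec, dotProduct]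
  obtain ⟨V, _, _, _, N, T, L, R, hT, hR, hN⟩ :=
    Estimable.of_detectable (A := (A.map Complex.ofReal).mulVecLin)
      (C := (C.map Complex.ofReal).mulVecLin) (k := (K.map Complex.ofReal).mulVecLin)
      (fun lam hlam v h1 h2 => by
        have hpow : ∀ j : ℕ,
            ((lam • 1 - (A.map Complex.ofReal).mulVecLin) ^ j : Module.End ℂ (Fin n → ℂ)) =
            ((lam • (1 : Matrix (Fin n) (Fin n) ℂ) - A.map Complex.ofReal) ^ j).mulVecLin := by
          intro j
          change (lam • 1 - Matrix.toLinAlgEquiv' (A.map Complex.ofReal)) ^ j =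
            Matrix.toLinAlgEquiv' ((lam • 1 - A.map Complex.ofReal) ^ j)
          rw [map_pow, map_sub, map_smul, map_one]
        refine hdet lam hlam v (fun j _ => ?_) ?_
        · have := h1 j
          rwa [hpow, Matrix.mulVecLin_apply, Matrix.mulVecLin_apply, Matrix.mulVec_mulVec] at this
        · rwa [hpow, Module.finrank_fin_fun, Matrix.mulVecLin_apply] at h2)
  let φ : V ≃ₗ[ℝ] (Fin (Module.finrank ℝ V) → ℝ) := (Module.finBasis ℝ V).equivFun
  let ι : (a : ℕ) → (Fin a → ℝ) →ₗ[ℝ] (Fin a → ℂ) :=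
    fun a => Complex.ofRealCLM.toLinearMap.compLeft (Fin a)
  let ρ : (Fin r → ℂ) →ₗ[ℝ] (Fin r → ℝ) := Complex.reCLM.toLinearMap.compLeft (Fin r)
  let L' : (Fin p → ℝ) →ₗ[ℝ] (Fin (Module.finrank ℝ V) → ℝ) :=
    φ.toLinearMap ∘ₗ L.restrictScalars ℝ ∘ₗ ι p
  let T' : (Fin n → ℝ) →ₗ[ℝ] V := T.restrictScalars ℝ ∘ₗ ι n
  refine ⟨Module.finrank ℝ V,
    LinearMap.toMatrix' (φ.toLinearMap ∘ₗ N.restrictScalars ℝ ∘ₗ φ.symm.toLinearMap),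
    LinearMap.toMatrix' (φ.toLinearMap ∘ₗ T' ∘ₗ B.mulVecLin - L' ∘ₗ D.mulVecLin),
    LinearMap.toMatrix' L',
    LinearMap.toMatrix' (ρ ∘ₗ R.restrictScalars ℝ ∘ₗ φ.symm.toLinearMap),
    fun u _ x hx w hw hx' hw' => ?_⟩
  have he : Tendsto (fun t => φ.symm (w t) - T' (x t)) atTop (𝓝 0) := by
    refine hN _ fun t ht => ?_
    have h1 := (LinearMap.toContinuousLinearMap φ.symm.toLinearMap).hasFDerivAt.comp_hasDerivAt t
      (hw t).hasDerivAt
    have h2 := (LinearMap.toContinuousLinearMap T').hasFDerivAt.comp_hasDerivAt t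
      (hx t).hasDerivAt
    refine (h1.sub h2).congr_deriv ?_
    have h3 : T' (A.mulVec (x t)) = N (T' (x t)) + L (ι p (C.mulVec (x t))) := by
      have := hT (ι n (x t))
      simp only [Matrix.mulVecLin_apply] at this
      rwa [hcoe, hcoe] at this
    simp only [LinearMap.coe_toContinuousLinearMap', LinearEquiv.coe_coe]
    rw [hx' t ht, hw' t ht]
    simp only [LinearMap.toMatrix'_mulVec]
    simp only [map_add, h3, map_sub, LinearMap.sub_apply]
    simp [L']
    abel
  have hρ : Tendsto (fun t => ρ (R (φ.symm (w t) - T' (x t)))) atTop (𝓝 0) := by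
    have := ((ρ ∘ₗ R.restrictScalars ℝ).continuous_of_finiteDimensional.tendsto 0).comp he
    simpa [Function.comp_def] using this
  refine hρ.congr fun t => ?_
  have h4 : R (T' (x t)) = ι r (K.mulVec (x t)) := (hR _).trans (hcoe K (x t))
  rw [map_sub, map_sub, h4, LinearMap.toMatrix'_mulVec]
  congr 1
end

section
/- (Theorem 3, sufficiency.) Let G be a connected simple graph on vertices {1,…,l} with l ≥ 1, and let a_{ij} = 1 if i and j are adjacent in G and a_{ij} = 0 otherwise. Let A ∈ ℝ^{n×n}, B ∈ ℝ^{n×m}, C_i ∈ ℝ^{p_i×n}, D_i ∈ ℝ^{p_i×m} for i = 1,…,l, K ∈ ℝ^{r×n}, and let C̃ be the vertical stack of C₁,…,C_l. Assume the system is jointly partially detectable with respect to K, i.e., for every λ ∈ ℂ with Re λ ≥ 0, every v ∈ ℂⁿ with C̃(λI−A)^j v = 0 for all j = 0,…,n−1 and (λI−A)^n v = 0 satisfies Kv = 0. Then there exist a nonnegative integer q, matrices N_i, M_i ∈ ℝ^{q×q}, H_i ∈ ℝ^{q×m}, L_i ∈ ℝ^{q×p_i}, R_i ∈ ℝ^{r×q}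 for i = 1,…,l, and a scalar γ > 0 such that: for every continuous u : ℝ → ℝ^m, every differentiable x : ℝ → ℝⁿ with x'(t) = A x(t) + B u(t) for all t ≥ 0, and all differentiable w₁,…,w_l : ℝ → ℝ^q satisfying, for all t ≥ 0 and each i, w_i'(t) = N_i w_i(t) + H_i u(t) + L_i (C_i x(t) + D_i u(t)) + γ M_i ∑_{j=1}^{l} a_{ij} (w_j(t) − w_i(t)), one has R_i w_i(t) − K x(t) → 0 as t → ∞ for every i = 1,…,l. -/
open Matrix

lemma Matrix.exists_mul_mul_eq_self {m n : Type*} [Fintype m] [Fintype n]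
    [DecidableEq m] [DecidableEq n] {𝕜 : Type*} [Field 𝕜] (X : Matrix m n 𝕜) :
    ∃ Y : Matrix n m 𝕜, X * Y * X = X := by
  obtain ⟨g, hg⟩ := (toLin' X).rangeRestrict.exists_rightInverse_of_surjective
    (LinearMap.range_rangeRestrict _)
  obtain ⟨h, hh⟩ := LinearMap.exists_extend g
  refine ⟨LinearMap.toMatrix' h, toLin'.injective (LinearMap.ext fun v => ?_)⟩
  have h1 : h (toLin' X v) = g ((toLin' X).rangeRestrict v) := by
    rw [← hh]; rfl
  have h2 := congrArg Subtype.val (LinearMap.congr_fun hg ((toLin' X).rangeRestrict v))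
  simp only [LinearMap.comp_apply, LinearMap.id_apply] at h2
  rw [toLin'_mul, toLin'_mul, toLin'_toMatrix', LinearMap.comp_apply, LinearMap.comp_apply, h1]
  exact h2

lemma Matrix.exists_eq_mul_of_forall_mulVec_eq_zero {k m n : Type*} [Fintype m] [Fintype n]
    [DecidableEq m] [DecidableEq n] {𝕜 : Type*} [Field 𝕜] (X : Matrix m n 𝕜) (N : Matrix k n 𝕜)
    (h : ∀ v, X *ᵥ v = 0 → N *ᵥ v = 0) : ∃ Y : Matrix k m 𝕜, N = Y * X := by
  obtain ⟨G, hG⟩ := X.exists_mul_mul_eq_self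
  refine ⟨N * G, ?_⟩
  refine ext_of_mulVec_single fun i => ?_
  have := h (Pi.single i 1 - (G * X) *ᵥ Pi.single i 1) (by
    rw [mulVec_sub, mulVec_mulVec, ← Matrix.mul_assoc, hG, sub_self])
  rw [mulVec_sub, mulVec_mulVec, ← Matrix.mul_assoc] at this
  exact sub_eq_zero.1 this

lemma Complex.map_ofReal_mulVec_eq_zero {m n : Type*} [Fintype n] (M : Matrix m n ℝ)
    (v : n → ℂ) : M.map Complex.ofReal *ᵥ v = 0 ↔
      M *ᵥ (fun i => (v i).re) = 0 ∧ M *ᵥ (fun i => (v i).im) = 0 := by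
  simp only [funext_iff, mulVec, dotProduct, ← forall_and]
  refine forall_congr' fun i => ?_
  rw [Complex.ext_iff]
  simp

lemma Complex.map_ofReal_mul {k m n : Type*} [Fintype n] (M : Matrix k n ℝ) (N : Matrix n m ℝ) :
    (M * N).map Complex.ofReal = M.map Complex.ofReal * N.map Complex.ofReal :=
  Matrix.map_mul (f := Complex.ofRealHom)

/-- The projection along the unobservable subspace of the pair `(S, A)`. -/
lemma exists_projection_along_unobservable {s n : Type*} [Fintype n] [DecidableEq n]
    (S : Matrix s n ℝ) (A : Matrix n n ℝ) :
    ∃ Q : Matrix n n ℝ, Q * Q = Q ∧ Q * A * Q = Q * A ∧ S * Q = S ∧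
      ∀ v : n → ℂ, (∀ j : ℕ, (S.map Complex.ofReal * A.map Complex.ofReal ^ j) *ᵥ v = 0) →
        Q.map Complex.ofReal *ᵥ v = 0 := by
  let W : Submodule ℝ (n → ℝ) := ⨅ j : ℕ, (S * A ^ j).mulVecLin.ker
  have hW : ∀ v, v ∈ W ↔ ∀ j : ℕ, (S * A ^ j) *ᵥ v = 0 := fun v => by
    simp [W, Submodule.mem_iInf]
  obtain ⟨U, hU⟩ := W.exists_isCompl
  let π := U.projection W hU.symm
  have hπ : ∀ v, π v = 0 ↔ v ∈ W := fun v => by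
    rw [← LinearMap.mem_ker, Submodule.ker_projection]
  have hidem : ∀ v, π (π v) = π v := fun v =>
    LinearMap.congr_fun (Submodule.isIdempotentElem_projection hU.symm) v
  have hQ : ∀ v, LinearMap.toMatrix' π *ᵥ v = π v := fun v => by
    rw [← toLin'_apply, toLin'_toMatrix']
  have hsub : ∀ v, v - π v ∈ W := fun v => by
    rw [← hπ, map_sub, hidem, sub_self]
  refine ⟨LinearMap.toMatrix' π, ?_, ?_, ?_, ?_⟩
  · refine ext_of_mulVec_single fun i => ?_
    rw [← mulVec_mulVec, hQ, hQ, hidem]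
  · refine ext_of_mulVec_single fun i => ?_
    rw [← mulVec_mulVec, ← mulVec_mulVec, ← mulVec_mulVec, hQ, hQ, hQ, ← sub_eq_zero, ← map_sub,
      ← mulVec_sub, hπ, hW]
    intro j
    have := (hW _).1 (hsub (Pi.single i 1)) (j + 1)
    rw [← neg_sub, mulVec_neg, mulVec_neg, mulVec_mulVec, Matrix.mul_assoc, ← pow_succ, this,
      neg_zero]
  · refine ext_of_mulVec_single fun i => ?_
    have := (hW _).1 (hsub (Pi.single i 1)) 0
    rw [pow_zero, Matrix.mul_one, mulVec_sub, sub_eq_zero] at this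
    rw [← mulVec_mulVec, hQ, this]
  · intro v hv
    have h : ∀ j : ℕ, (S * A ^ j).map Complex.ofReal *ᵥ v = 0 := fun j => by
      rw [Complex.map_ofReal_mul, ← hv j]
      exact congrArg (fun M => (S.map Complex.ofReal * M) *ᵥ v) (Matrix.map_pow A Complex.ofRealHom j)
    simp only [Complex.map_ofReal_mulVec_eq_zero] at h ⊢
    rw [hQ, hQ, hπ, hπ, hW, hW]
    exact ⟨fun j => (h j).1, fun j => (h j).2⟩

/-- If `T v` lies in a `T`-invariant subspace `W`, then `v` differs from an element of the
generalized kernel of `T` by an element of `W`. -/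
lemma Module.End.exists_sub_mem_ker_pow_finrank {𝕜 V : Type*} [Field 𝕜] [AddCommGroup V]
    [Module 𝕜 V] [FiniteDimensional 𝕜 V] (T : Module.End 𝕜 V) (W : Submodule 𝕜 V)
    (hW : ∀ w ∈ W, T w ∈ W) {v : V} (hv : T v ∈ W) :
    ∃ w ∈ W, (T ^ Module.finrank 𝕜 V) (v - w) = 0 := by
  let f : Module.End 𝕜 W := T.restrict hW
  obtain ⟨k, hk⟩ := Filter.eventually_atTop.1 (LinearMap.eventually_iInf_range_pow_eq f)
  have hmem : (f ^ k) ⟨T v, hv⟩ ∈ (f ^ (k + 1)).range := by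
    rw [← hk (k + 1) (by omega), hk k le_rfl]
    exact ⟨_, rfl⟩
  obtain ⟨w, hw⟩ := hmem
  refine ⟨w, w.2, ?_⟩
  have hcoe : ∀ (j : ℕ) (x : W), (((f ^ j) x : W) : V) = (T ^ j) x := fun j x => by
    rw [Module.End.pow_restrict j]; rfl
  have := congrArg Subtype.val hw
  rw [hcoe, hcoe] at this
  refine LinearMap.mem_ker.1 (Module.End.ker_pow_le_ker_pow_finrank T (k + 1) ?_)
  rw [LinearMap.mem_ker, map_sub, this, pow_succ]
  simp

lemma detectable_of_partially_detectable {c r n : Type*} [Fintype n] [DecidableEq n]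
    (A : Matrix n n ℝ) (C : Matrix c n ℝ) (K : Matrix r n ℝ)
    (hdet : ∀ lam : ℂ, 0 ≤ lam.re → ∀ v : n → ℂ,
      (∀ j : ℕ, (C.map Complex.ofReal *
          (lam • (1 : Matrix n n ℂ) - A.map Complex.ofReal) ^ j) *ᵥ v = 0) →
      ((lam • (1 : Matrix n n ℂ) - A.map Complex.ofReal) ^ Fintype.card n) *ᵥ v = 0 →
      K.map Complex.ofReal *ᵥ v = 0) :
    ∃ Q F : Matrix n n ℝ, F * Q = Q * A ∧ C * Q = C ∧ K * Q = K ∧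
      ∀ lam : ℂ, 0 ≤ lam.re → ∀ v : n → ℂ, F.map Complex.ofReal *ᵥ v = lam • v →
        C.map Complex.ofReal *ᵥ v = 0 → v = 0 := by
  obtain ⟨Q, hQQ, hQA, hSQ, hQ⟩ := exists_projection_along_unobservable (fromRows C K) A
  rw [fromRows_mul] at hSQ
  obtain ⟨hCQ, hKQ⟩ := fromRows_inj hSQ
  refine ⟨Q, Q * A - (1 - Q), ?_, hCQ, hKQ, ?_⟩
  · rw [sub_mul, hQA, sub_mul, hQQ, one_mul, sub_self, sub_zero]
  intro lam hlam v hv hCv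
  set Ac := A.map Complex.ofReal with hAc
  set Cc := C.map Complex.ofReal with hCc
  set Kc := K.map Complex.ofReal with hKc
  set Qc := Q.map Complex.ofReal with hQc
  have hQQc : Qc * Qc = Qc := by rw [hQc, ← Complex.map_ofReal_mul, hQQ]
  have hQAc : Qc * Ac * Qc = Qc * Ac := by
    rw [hQc, hAc, ← Complex.map_ofReal_mul, ← Complex.map_ofReal_mul, hQA]
  have hCQc : Cc * Qc = Cc := by rw [hQc, hCc, ← Complex.map_ofReal_mul, hCQ]
  have hKQc : Kc * Qc = Kc := by rw [hQc, hKc, ← Complex.map_ofReal_mul, hKQ]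
  have hF : (Q * A - (1 - Q)).map Complex.ofReal = Qc * Ac - (1 - Qc) := by
    rw [hQc, hAc, ← Complex.map_ofReal_mul]
    ext i j
    simp [Matrix.one_apply, apply_ite]
  rw [hF] at hv
  have hQv : Qc *ᵥ v = v := by
    have h1 := congrArg (fun x => (1 - Qc) *ᵥ x) hv
    have h2 : (1 - Qc) * (Qc * Ac - (1 - Qc)) = -(1 - Qc) := by
      have : (1 - Qc) * Qc = 0 := by rw [sub_mul, hQQc, one_mul, sub_self]
      rw [mul_sub, ← Matrix.mul_assoc, this, Matrix.zero_mul, mul_sub, this, mul_one]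
      simp
    simp only [mulVec_mulVec, h2, mulVec_smul, neg_mulVec] at h1
    have h3 : (lam + 1) • ((1 - Qc) *ᵥ v) = 0 := by
      rw [add_smul, one_smul, ← h1, neg_add_cancel]
    have h4 : lam + 1 ≠ 0 := fun h => by
      have := congrArg Complex.re h
      simp at this
      linarith
    rw [smul_eq_zero_iff_right h4, sub_mulVec, one_mulVec, sub_eq_zero] at h3
    exact h3.symm
  let T := lam • (1 : Matrix n n ℂ) - Ac
  let W : Submodule ℂ (n → ℂ) := Qc.mulVecLin.ker
  have hWmem : ∀ w, w ∈ W ↔ Qc *ᵥ w = 0 := fun w => by simp [W]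
  have hWA : ∀ w ∈ W, Ac *ᵥ w ∈ W := fun w hw => by
    rw [hWmem] at hw ⊢
    rw [mulVec_mulVec, ← hQAc, ← mulVec_mulVec, hw, mulVec_zero]
  have hWT : ∀ w ∈ W, T *ᵥ w ∈ W := fun w hw => by
    have : T *ᵥ w = lam • w - Ac *ᵥ w := by simp [T, sub_mulVec, smul_mulVec]
    rw [this]
    exact W.sub_mem (W.smul_mem _ hw) (hWA w hw)
  have hWC : ∀ w ∈ W, Cc *ᵥ w = 0 := fun w hw => by
    rw [← hCQc, ← mulVec_mulVec, (hWmem w).1 hw, mulVec_zero]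
  have hWK : ∀ w ∈ W, Kc *ᵥ w = 0 := fun w hw => by
    rw [← hKQc, ← mulVec_mulVec, (hWmem w).1 hw, mulVec_zero]
  have hTv' : T *ᵥ v = lam • v - Ac *ᵥ v := by simp [T, sub_mulVec, smul_mulVec]
  have hTv : T *ᵥ v ∈ W := by
    rw [hWmem, hTv', mulVec_sub, mulVec_smul, hQv, sub_eq_zero, mulVec_mulVec, ← hv,
      sub_mulVec (Qc * Ac), sub_mulVec, one_mulVec, hQv, sub_self, sub_zero]
  obtain ⟨w, hw, hw0⟩ := Module.End.exists_sub_mem_ker_pow_finrank (toLin' T) W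
    (fun w hw => by simpa using hWT w hw) (v := v) (by simpa using hTv)
  rw [Module.finrank_fintype_fun_eq_card, ← toLin'_pow, toLin'_apply] at hw0
  have hTC : ∀ j : ℕ, Cc *ᵥ (T ^ j *ᵥ (v - w)) = 0 := by
    intro j
    rcases j with _ | j
    · rw [pow_zero, one_mulVec, mulVec_sub, hCv, hWC w hw, sub_zero]
    · apply hWC
      induction j with
      | zero =>
        rw [zero_add, pow_one, mulVec_sub]
        exact W.sub_mem hTv (hWT w hw)
      | succ j ih =>
        rw [pow_succ', ← mulVec_mulVec]
        exact hWT _ ih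
  have hKv : Kc *ᵥ v = 0 := by
    have := hdet lam hlam (v - w) (fun j => by rw [← mulVec_mulVec]; exact hTC j) hw0
    rwa [mulVec_sub, hWK w hw, sub_zero] at this
  rw [← hQv]
  refine hQ v fun j => ?_
  have hAj : ∃ μ : ℂ, ∃ y ∈ W, Ac ^ j *ᵥ v = μ • v + y := by
    induction j with
    | zero => exact ⟨1, 0, W.zero_mem, by simp⟩
    | succ j ih =>
      obtain ⟨μ, y, hy, h⟩ := ih
      refine ⟨μ * lam, Ac *ᵥ y - μ • (T *ᵥ v), W.sub_mem (hWA y hy) (W.smul_mem _ hTv), ?_⟩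
      rw [pow_succ', ← mulVec_mulVec, h, hTv', mulVec_add, mulVec_smul, smul_sub, smul_smul]
      abel
  obtain ⟨μ, y, hy, h⟩ := hAj
  rw [← mulVec_mulVec, h, fromRows_map, fromRows_mulVec, mulVec_add, mulVec_add, mulVec_smul,
    mulVec_smul, hWC y hy, hWK y hy, hCv, hKv]
  ext i
  rcases i with i | i <;> simp

lemma Matrix.exists_unstable_unobservable_eigenvector {c n : Type*} [Fintype n] [DecidableEq n]
    (F : Matrix n n ℝ) (C : Matrix c n ℝ) {X : Matrix n n ℝ} (hX : X.PosSemidef) (hX0 : X ≠ 0)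
    (hCX : C * X = 0) (hFX : ∀ v, 0 ≤ v ⬝ᵥ (F * X) *ᵥ v) :
    ∃ lam : ℂ, 0 ≤ lam.re ∧ ∃ v : n → ℂ, v ≠ 0 ∧ F.map Complex.ofReal *ᵥ v = lam • v ∧
      C.map Complex.ofReal *ᵥ v = 0 := by
  have hXT : Xᵀ = X := hX.isHermitian.eq
  have hswap : ∀ v : n → ℝ, v ⬝ᵥ (X * Fᵀ) *ᵥ v = v ⬝ᵥ (F * X) *ᵥ v := fun v => by
    rw [dotProduct_mulVec, dotProduct_comm, ← mulVec_transpose, transpose_mul, hXT,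
      transpose_transpose]
  have hM : (F * X + X * Fᵀ).PosSemidef := by
    refine .of_dotProduct_mulVec_nonneg ?_ fun v => ?_
    · rw [IsHermitian, conjTranspose_eq_transpose_of_trivial, transpose_add, transpose_mul,
        transpose_mul, transpose_transpose, hXT, add_comm]
    · rw [add_mulVec, dotProduct_add, star_trivial, hswap]
      linarith [hFX v]
  have hker : ∀ v, X *ᵥ v = 0 → (X * Fᵀ) *ᵥ v = 0 := fun v hv => by
    have h0 : (F * X) *ᵥ v = 0 := by rw [← mulVec_mulVec, hv, mulVec_zero]
    have := (hM.dotProduct_mulVec_zero_iff v).1 (by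
      rw [add_mulVec, dotProduct_add, star_trivial, hswap, h0]; simp)
    rwa [add_mulVec, h0, zero_add] at this
  obtain ⟨Y, hY⟩ := X.exists_eq_mul_of_forall_mulVec_eq_zero _ hker
  have hFXY : F * X = X * Yᵀ := by
    have := congrArg transpose hY
    rwa [transpose_mul, transpose_mul, hXT, transpose_transpose] at this
  have hFXc : F.map Complex.ofReal * X.map Complex.ofReal =
      X.map Complex.ofReal * Yᵀ.map Complex.ofReal := by
    rw [← Complex.map_ofReal_mul, hFXY, Complex.map_ofReal_mul]
  let U : Submodule ℂ (n → ℂ) := (X.map Complex.ofReal).mulVecLin.range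
  have hU : ∀ u ∈ U, toLin' (F.map Complex.ofReal) u ∈ U := by
    rintro _ ⟨z, rfl⟩
    refine ⟨Yᵀ.map Complex.ofReal *ᵥ z, ?_⟩
    rw [mulVecLin_apply, mulVecLin_apply, toLin'_apply, mulVec_mulVec, mulVec_mulVec, hFXc]
  have hUne : Nontrivial U := by
    rw [Submodule.nontrivial_iff_ne_bot]
    intro h
    rw [LinearMap.range_eq_bot] at h
    apply hX0
    have h' : X.map Complex.ofReal = 0 := by
      rw [← Matrix.mulVecLin_zero] at h
      exact ext_of_mulVec_single fun i => LinearMap.congr_fun h (Pi.single i 1)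
    ext i j
    have := congrFun (congrFun h' i) j
    simpa using this
  obtain ⟨lam, hlam⟩ := Module.End.exists_eigenvalue ((toLin' (F.map Complex.ofReal)).restrict hU)
  obtain ⟨⟨u, hu⟩, hu1, hu0⟩ := hlam.exists_hasEigenvector
  rw [Module.End.mem_eigenspace_iff] at hu1
  have hFu : F.map Complex.ofReal *ᵥ u = lam • u := congrArg Subtype.val hu1
  obtain ⟨z, rfl⟩ := hu
  rw [mulVecLin_apply] at hFu
  have hu0' : X.map Complex.ofReal *ᵥ z ≠ 0 := fun h => hu0 (Subtype.ext h)
  refine ⟨lam, ?_, _, hu0', hFu, ?_⟩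
  swap
  · rw [mulVec_mulVec, ← Complex.map_ofReal_mul, hCX]
    simp [Matrix.map_zero]
  rw [mulVec_mulVec, ← Complex.map_ofReal_mul] at hFu
  set a : n → ℝ := fun i => (z i).re with ha
  set b : n → ℝ := fun i => (z i).im with hb
  have hre : ∀ (N : Matrix n n ℝ) i, ((N.map Complex.ofReal *ᵥ z) i).re = (N *ᵥ a) i := by
    intro N i; simp [mulVec, dotProduct, ha]
  have him : ∀ (N : Matrix n n ℝ) i, ((N.map Complex.ofReal *ᵥ z) i).im = (N *ᵥ b) i := by
    intro N i; simp [mulVec, dotProduct, hb]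
  have hFa : (F * X) *ᵥ a = lam.re • (X *ᵥ a) - lam.im • (X *ᵥ b) := by
    ext i
    rw [← hre, hFu]
    simp [hre, him]
  have hFb : (F * X) *ᵥ b = lam.re • (X *ᵥ b) + lam.im • (X *ᵥ a) := by
    ext i
    rw [← him, hFu]
    simp [hre, him]
  have hab : a ⬝ᵥ X *ᵥ b = b ⬝ᵥ X *ᵥ a := by
    rw [dotProduct_mulVec, dotProduct_comm, ← mulVec_transpose, hXT]
  have h1 := hFX a
  have h2 := hFX b
  rw [hFa, dotProduct_sub, dotProduct_smul, dotProduct_smul, smul_eq_mul, smul_eq_mul] at h1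
  rw [hFb, dotProduct_add, dotProduct_smul, dotProduct_smul, smul_eq_mul, smul_eq_mul, ← hab] at h2
  have ha0 := hX.dotProduct_mulVec_nonneg a
  have hb0 := hX.dotProduct_mulVec_nonneg b
  rw [star_trivial] at ha0 hb0
  have hpos : 0 < a ⬝ᵥ X *ᵥ a + b ⬝ᵥ X *ᵥ b := by
    refine lt_of_le_of_ne (by positivity) fun h => hu0' ?_
    rw [Complex.map_ofReal_mulVec_eq_zero]
    exact ⟨(hX.dotProduct_mulVec_zero_iff a).1 (by rw [star_trivial]; linarith),
      (hX.dotProduct_mulVec_zero_iff b).1 (by rw [star_trivial]; linarith)⟩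
  by_contra hneg
  nlinarith [mul_pos_of_neg_of_neg (not_le.1 hneg) (neg_neg_of_pos hpos)]

lemma Matrix.isOpen_setOf_dotProduct_mulVec_pos {n : Type*} [Fintype n] :
    IsOpen {M : Matrix n n ℝ | ∀ x, x ≠ 0 → 0 < x ⬝ᵥ M *ᵥ x} := by
  have h : {M : Matrix n n ℝ | ∀ x, x ≠ 0 → 0 < x ⬝ᵥ M *ᵥ x} =
      {M | ∀ x ∈ Metric.sphere (0 : n → ℝ) 1, 0 < x ⬝ᵥ M *ᵥ x} := by
    ext M
    refine ⟨fun h x hx => h x (Metric.ne_of_mem_sphere hx one_ne_zero), fun h x hx => ?_⟩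
    have hx' := norm_pos_iff.2 hx
    have := h (‖x‖⁻¹ • x) (by simp [norm_smul, hx'.ne'])
    rw [mulVec_smul, dotProduct_smul, smul_dotProduct, smul_eq_mul, smul_eq_mul] at this
    rwa [mul_pos_iff_of_pos_left (inv_pos.2 hx'), mul_pos_iff_of_pos_left (inv_pos.2 hx')] at this
  rw [h]
  have hopen : IsOpen {q : Matrix n n ℝ × (n → ℝ) | 0 < q.2 ⬝ᵥ q.1 *ᵥ q.2} :=
    isOpen_lt continuous_const
      (continuous_snd.dotProduct (continuous_fst.matrix_mulVec continuous_snd))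
  rw [isOpen_iff_mem_nhds]
  exact fun M hM => (isCompact_sphere (0 : n → ℝ) 1).eventually_forall_of_forall_eventually
    (P := fun M x => 0 < x ⬝ᵥ M *ᵥ x) fun y hy => hopen.mem_nhds (hM y hy)

lemma Matrix.exists_forall_eq_trace_mul {n : Type*} [Fintype n] [DecidableEq n]
    {R : Type*} [CommSemiring R] (f : Matrix n n R →ₗ[R] R) :
    ∃ X : Matrix n n R, ∀ Y, f Y = (X * Y).trace := by
  refine ⟨of fun i j => f (single j i 1), fun Y => ?_⟩
  conv_lhs => rw [matrix_eq_sum_single Y]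
  simp only [map_sum, trace, diag_apply, mul_apply, of_apply]
  rw [Finset.sum_comm]
  refine Finset.sum_congr rfl fun i _ => Finset.sum_congr rfl fun j _ => ?_
  rw [← mul_one (Y j i), ← smul_eq_mul (Y j i), ← smul_single, map_smul, smul_eq_mul, smul_eq_mul,
    mul_one, mul_comm]

/-- Linear functionals that separate positive definite pairs from the Lyapunov inequality for
`(F, C)` are represented by a dual certificate. -/
lemma Matrix.exists_posSemidef_of_separating {c n : Type*} [Fintype c] [Fintype n]
    [DecidableEq n] (F : Matrix n n ℝ) (C : Matrix c n ℝ) (f g : Matrix n n ℝ →ₗ[ℝ] ℝ)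
    (hpos : ∀ M : Matrix n n ℝ, (∀ x, x ≠ 0 → 0 < x ⬝ᵥ M *ᵥ x) →
      ∀ N : Matrix n n ℝ, (∀ x, x ≠ 0 → 0 < x ⬝ᵥ N *ᵥ x) → 0 < f M + g N)
    (hfg : ∀ P, f (P + Pᵀ) = g ((P + Pᵀ) * F)) (hgC : g (Cᵀ * C) = 0) :
    ∃ X : Matrix n n ℝ, X.PosSemidef ∧ X ≠ 0 ∧ C * X = 0 ∧ ∀ v, 0 ≤ v ⬝ᵥ (F * X) *ᵥ v := by
  have hone : ∀ x : n → ℝ, x ≠ 0 → 0 < x ⬝ᵥ (1 : Matrix n n ℝ) *ᵥ x := fun x hx => by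
    rw [one_mulVec]
    simpa using dotProduct_star_self_pos_iff.2 hx
  have h11 := hpos 1 hone 1 hone
  have hnonneg : ∀ M N : Matrix n n ℝ, (∀ x, 0 ≤ x ⬝ᵥ M *ᵥ x) → (∀ x, 0 ≤ x ⬝ᵥ N *ᵥ x) →
      0 ≤ f M + g N := by
    intro M N hM hN
    have key : ∀ ε : ℝ, 0 < ε → 0 < f M + g N + ε * (f 1 + g 1) := by
      intro ε hε
      have hmem : ∀ M : Matrix n n ℝ, (∀ x, 0 ≤ x ⬝ᵥ M *ᵥ x) →
          ∀ x, x ≠ 0 → 0 < x ⬝ᵥ (M + ε • 1) *ᵥ x := by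
        intro M hM x hx
        rw [add_mulVec, dotProduct_add, smul_mulVec, dotProduct_smul, smul_eq_mul]
        exact add_pos_of_nonneg_of_pos (hM x) (mul_pos hε (hone x hx))
      have := hpos _ (hmem M hM) _ (hmem N hN)
      rw [map_add, map_add, map_smul, map_smul, smul_eq_mul, smul_eq_mul] at this
      linarith
    by_contra hneg
    rw [not_le] at hneg
    have := key (-(f M + g N) / (f 1 + g 1)) (div_pos (neg_pos.2 hneg) h11)
    rw [div_mul_cancel₀ _ h11.ne'] at this
    linarith
  obtain ⟨X, hX⟩ := exists_forall_eq_trace_mul g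
  have hzero : ∀ x : n → ℝ, (0 : ℝ) ≤ x ⬝ᵥ (0 : Matrix n n ℝ) *ᵥ x := by simp
  have hf : ∀ M : Matrix n n ℝ, (∀ x, 0 ≤ x ⬝ᵥ M *ᵥ x) → 0 ≤ f M := fun M hM => by
    simpa using hnonneg M 0 hM hzero
  have hg : ∀ N : Matrix n n ℝ, (∀ x, 0 ≤ x ⬝ᵥ N *ᵥ x) → 0 ≤ (X * N).trace := fun N hN => by
    rw [← hX]
    simpa using hnonneg 0 N hzero hN
  have hrank : ∀ (M : Matrix n n ℝ) (v w : n → ℝ), (M * vecMulVec v w).trace = w ⬝ᵥ M *ᵥ v := by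
    intro M v w
    rw [mul_vecMulVec, trace_vecMulVec, dotProduct_comm]
  have hsq : ∀ v x : n → ℝ, 0 ≤ x ⬝ᵥ vecMulVec v v *ᵥ x := by
    intro v x
    rw [vecMulVec_mulVec, op_smul_eq_smul, dotProduct_smul, smul_eq_mul, dotProduct_comm x]
    exact mul_self_nonneg _
  have hXnonneg : ∀ v, 0 ≤ v ⬝ᵥ X *ᵥ v := fun v => by
    rw [← hrank]
    exact hg _ (hsq v)
  have hXsymm : ∀ v w, w ⬝ᵥ X *ᵥ v = v ⬝ᵥ X *ᵥ w := by
    have h : ∀ v w : n → ℝ, v ⬝ᵥ X *ᵥ w ≤ w ⬝ᵥ X *ᵥ v := by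
      intro v w
      have := hg (vecMulVec v w - vecMulVec w v) (fun x => by
        rw [sub_mulVec, vecMulVec_mulVec, vecMulVec_mulVec, op_smul_eq_smul, op_smul_eq_smul,
          dotProduct_sub, dotProduct_smul, dotProduct_smul, smul_eq_mul, smul_eq_mul,
          dotProduct_comm x, dotProduct_comm x, mul_comm, sub_self])
      rw [mul_sub, trace_sub, hrank, hrank] at this
      linarith
    exact fun v w => le_antisymm (h w v) (h v w)
  have hXpsd : X.PosSemidef := by
    refine .of_dotProduct_mulVec_nonneg ?_ hXnonneg
    ext i j
    simpa using hXsymm (Pi.single i 1) (Pi.single j 1)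
  refine ⟨X, hXpsd, ?_, ?_, fun v => ?_⟩
  · rintro rfl
    have h1 := hfg ((1 / 2 : ℝ) • 1)
    have h2 : ((1 / 2 : ℝ) • (1 : Matrix n n ℝ)) + ((1 / 2 : ℝ) • (1 : Matrix n n ℝ))ᵀ = 1 := by
      rw [transpose_smul, transpose_one, ← add_smul]; norm_num
    rw [h2] at h1
    rw [h1, hX, hX, Matrix.zero_mul, Matrix.zero_mul, trace_zero, add_zero] at h11
    exact h11.false
  · rw [hX, ← Matrix.mul_assoc, trace_mul_comm, ← Matrix.mul_assoc] at hgC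
    have hterm : ∀ i, (C * X * Cᵀ) i i = C i ⬝ᵥ X *ᵥ C i := by
      intro i
      rw [dotProduct_mulVec]
      rfl
    have h0 := (Finset.sum_eq_zero_iff_of_nonneg (fun i _ => by
      rw [diag_apply, hterm]; exact hXnonneg _)).1 hgC
    ext i j
    have := (hXpsd.dotProduct_mulVec_zero_iff (C i)).1 (by
      rw [star_trivial, ← hterm]; exact h0 i (Finset.mem_univ i))
    rw [← hXpsd.isHermitian.eq, conjTranspose_eq_transpose_of_trivial, mulVec_transpose] at this
    exact congrFun this j
  · have h2 := hf (vecMulVec v v + (vecMulVec v v)ᵀ) (fun x => by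
      rw [transpose_vecMulVec, add_mulVec, dotProduct_add]
      exact add_nonneg (hsq v x) (hsq v x))
    rw [hfg, hX, transpose_vecMulVec, ← Matrix.mul_assoc, trace_mul_comm, ← Matrix.mul_assoc,
      mul_add, trace_add, hrank] at h2
    linarith

/-- A theorem of alternatives: a linear map either meets a product of open convex sets, or a pair
of linear functionals separates its range from that product. -/
lemma exists_mem_or_exists_separating {V E F : Type*} [AddCommGroup V] [Module ℝ V]
    [TopologicalSpace E] [AddCommGroup E] [Module ℝ E] [IsTopologicalAddGroup E]
    [ContinuousSMul ℝ E] [TopologicalSpace F] [AddCommGroup F] [Module ℝ F]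
    [IsTopologicalAddGroup F] [ContinuousSMul ℝ F] (φ : V →ₗ[ℝ] E) (ψ : V →ₗ[ℝ] F)
    {s : Set E} {t : Set F} (hs : Convex ℝ s) (hs' : IsOpen s) (ht : Convex ℝ t) (ht' : IsOpen t) :
    (∃ v, φ v ∈ s ∧ ψ v ∈ t) ∨
      ∃ (f : E →ₗ[ℝ] ℝ) (g : F →ₗ[ℝ] ℝ), (∀ x ∈ s, ∀ y ∈ t, 0 < f x + g y) ∧
        ∀ v, f (φ v) + g (ψ v) = 0 := by
  by_cases hdisj : Disjoint (s ×ˢ t) ((φ.prod ψ).range : Set (E × F))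
  swap
  · obtain ⟨_, hq, v, rfl⟩ := Set.not_disjoint_iff.1 hdisj
    exact Or.inl ⟨v, hq⟩
  obtain ⟨f, u, hf, hfV⟩ := geometric_hahn_banach_open (hs.prod ht) (hs'.prod ht')
    (φ.prod ψ).range.convex hdisj
  have hu : u ≤ 0 := by simpa using hfV 0 (φ.prod ψ).range.zero_mem
  have hsplit : ∀ x y, f (x, y) = f (x, 0) + f (0, y) := fun x y => by
    rw [← map_add, Prod.mk_add_mk, add_zero, zero_add]
  refine Or.inr ⟨-(f : E × F →ₗ[ℝ] ℝ) ∘ₗ LinearMap.inl ℝ E F,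
    -(f : E × F →ₗ[ℝ] ℝ) ∘ₗ LinearMap.inr ℝ E F, fun x hx y hy => ?_, fun v => ?_⟩
  · have := (hf (x, y) ⟨hx, hy⟩).trans_le hu
    rw [hsplit] at this
    simp only [LinearMap.neg_apply, LinearMap.comp_apply,
      LinearMap.inl_apply, LinearMap.inr_apply, ContinuousLinearMap.coe_coe]
    linarith
  · have h0 : f (φ v, ψ v) = 0 := by
      by_contra h
      have := hfV (((u - 1) / f (φ v, ψ v)) • (φ v, ψ v))
        ((φ.prod ψ).range.smul_mem _ ⟨v, rfl⟩)
      rw [map_smul, smul_eq_mul, div_mul_cancel₀ _ h] at this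
      linarith
    rw [hsplit] at h0
    simp only [LinearMap.neg_apply, LinearMap.comp_apply,
      LinearMap.inl_apply, LinearMap.inr_apply, ContinuousLinearMap.coe_coe]
    linarith

/-- A detectable pair `(F, C)` admits a quadratic Lyapunov certificate. -/
lemma Matrix.exists_posDef_lyapunov_of_detectable {c n : Type*} [Fintype c] [Fintype n]
    [DecidableEq n] (F : Matrix n n ℝ) (C : Matrix c n ℝ)
    (hdet : ∀ lam : ℂ, 0 ≤ lam.re → ∀ v : n → ℂ, F.map Complex.ofReal *ᵥ v = lam • v →
        C.map Complex.ofReal *ᵥ v = 0 → v = 0) :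
    ∃ (P : Matrix n n ℝ) (μ : ℝ), P.PosDef ∧
      ∀ x, x ≠ 0 → x ⬝ᵥ (P * F) *ᵥ x < μ * (C *ᵥ x ⬝ᵥ C *ᵥ x) := by
  have hconv : Convex ℝ {M : Matrix n n ℝ | ∀ x, x ≠ 0 → 0 < x ⬝ᵥ M *ᵥ x} := by
    refine (convex_iff_forall_pos).2 fun M hM N hN a b ha hb _ x hx => ?_
    rw [add_mulVec, dotProduct_add, smul_mulVec, smul_mulVec, dotProduct_smul, dotProduct_smul,
      smul_eq_mul, smul_eq_mul]
    exact add_pos (mul_pos ha (hM x hx)) (mul_pos hb (hN x hx))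
  let φ : Matrix n n ℝ × ℝ →ₗ[ℝ] Matrix n n ℝ :=
    (LinearMap.id + (transposeLinearEquiv n n ℝ ℝ).toLinearMap) ∘ₗ LinearMap.fst ℝ _ _
  let ψ : Matrix n n ℝ × ℝ →ₗ[ℝ] Matrix n n ℝ :=
    (LinearMap.snd ℝ (Matrix n n ℝ) ℝ).smulRight (Cᵀ * C) - LinearMap.mulRight ℝ F ∘ₗ φ
  have hφ : ∀ P μ, φ (P, μ) = P + Pᵀ := fun P μ => rfl
  have hψ : ∀ P μ, ψ (P, μ) = μ • (Cᵀ * C) - (P + Pᵀ) * F := fun P μ => rfl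
  obtain ⟨⟨P, μ⟩, h1, h2⟩ | ⟨f, g, hpos, hfg⟩ := exists_mem_or_exists_separating φ ψ hconv
    isOpen_setOf_dotProduct_mulVec_pos hconv isOpen_setOf_dotProduct_mulVec_pos
  · rw [hφ] at h1
    rw [hψ] at h2
    refine ⟨P + Pᵀ, μ, .of_dotProduct_mulVec_pos ?_ fun x hx => ?_, fun x hx => ?_⟩
    · rw [IsHermitian, conjTranspose_eq_transpose_of_trivial, transpose_add, transpose_transpose,
        add_comm]
    · rw [star_trivial]
      exact h1 x hx
    · have := h2 x hx
      rw [sub_mulVec, dotProduct_sub, smul_mulVec, dotProduct_smul, smul_eq_mul,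
        ← mulVec_mulVec x Cᵀ, dotProduct_mulVec x, vecMul_transpose] at this
      linarith
  · exfalso
    obtain ⟨X, hXpsd, hX0, hCX, hFX⟩ := exists_posSemidef_of_separating F C f g
      (fun M hM N hN => hpos M hM N hN)
      (fun P => by
        have := hfg (P, 0)
        rw [hφ, hψ, zero_smul, zero_sub, map_neg] at this
        linarith)
      (by
        have := hfg (0, 1)
        rwa [hφ, hψ, transpose_zero, add_zero, one_smul, Matrix.zero_mul, sub_zero, map_zero,
          zero_add] at this)
    obtain ⟨lam, hlam, v, hv0, hv, hCv⟩ :=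
      exists_unstable_unobservable_eigenvector F C hXpsd hX0 hCX hFX
    exact hv0 (hdet lam hlam v hv hCv)

/-- Finsler's lemma for continuous functions that are homogeneous of degree two. -/
lemma exists_penalty {E : Type*} [NormedAddCommGroup E] [NormedSpace ℝ E] [FiniteDimensional ℝ E]
    {f g V : E → ℝ} (hf : Continuous f) (hg : Continuous g) (hV : Continuous V)
    (hf2 : ∀ (a : ℝ) x, f (a • x) = a ^ 2 * f x) (hg2 : ∀ (a : ℝ) x, g (a • x) = a ^ 2 * g x)
    (hV2 : ∀ (a : ℝ) x, V (a • x) = a ^ 2 * V x) (hg0 : ∀ x, 0 ≤ g x) (hV0 : ∀ x, 0 ≤ V x)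
    (hfg : ∀ x, x ≠ 0 → g x = 0 → f x < 0) :
    ∃ γ ε : ℝ, 0 < γ ∧ 0 < ε ∧ ∀ x, f x - γ * g x ≤ -ε * V x := by
  have : ProperSpace E := FiniteDimensional.proper_real E
  let U : ℕ → Set E := fun k => {x | f x - (k + 1) * g x + V x / (k + 1) < 0}
  have hU : ∀ k, IsOpen (U k) := fun k => isOpen_lt (by fun_prop) continuous_const
  have hmono : Monotone U := by
    intro k k' hkk' x hx
    have h1 : (k : ℝ) + 1 ≤ k' + 1 := by exact_mod_cast Nat.add_le_add_right hkk' 1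
    have h2 := mul_le_mul_of_nonneg_right h1 (hg0 x)
    have h3 := div_le_div_of_nonneg_left (hV0 x) (by positivity : (0 : ℝ) < k + 1) h1
    simp only [U, Set.mem_ofPred_eq] at hx ⊢
    linarith
  have hcover : Metric.sphere (0 : E) 1 ⊆ ⋃ k, U k := by
    intro x hx
    have hx0 := Metric.ne_of_mem_sphere hx one_ne_zero
    rw [Set.mem_iUnion]
    rcases (hg0 x).eq_or_lt with h | h
    · have hfx := hfg x hx0 h.symm
      obtain ⟨k, hk⟩ := exists_nat_gt (V x / -f x)
      refine ⟨k, ?_⟩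
      rw [div_lt_iff₀ (neg_pos.2 hfx)] at hk
      have : V x / (k + 1) < -f x := by
        rw [div_lt_iff₀ (by positivity)]
        linarith
      simp only [U, Set.mem_ofPred_eq, ← h]
      linarith
    · obtain ⟨k, hk⟩ := exists_nat_gt ((f x + V x) / g x)
      refine ⟨k, ?_⟩
      rw [div_lt_iff₀ h] at hk
      have : V x / (k + 1) ≤ V x := div_le_self (hV0 x) (by simp)
      simp only [U, Set.mem_ofPred_eq]
      linarith
  obtain ⟨k, hk⟩ := (isCompact_sphere (0 : E) 1).elim_directed_cover U hU hcover
    hmono.directed_le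
  refine ⟨k + 1, (k + 1 : ℝ)⁻¹, by positivity, by positivity, fun x => ?_⟩
  obtain ⟨a, y, hy, rfl⟩ : ∃ (a : ℝ) (y : E), (a = 0 ∨ y ∈ Metric.sphere (0 : E) 1) ∧ x = a • y := by
    rcases eq_or_ne x 0 with rfl | hx
    · exact ⟨0, 0, Or.inl rfl, by simp⟩
    · have hx' := norm_pos_iff.2 hx
      exact ⟨‖x‖, ‖x‖⁻¹ • x, Or.inr (by simp [norm_smul, hx'.ne']), by
        rw [smul_smul, mul_inv_cancel₀ hx'.ne', one_smul]⟩
  rw [hf2, hg2, hV2]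
  rcases hy with rfl | hy
  · simp
  · have h1 : f y - (k + 1) * g y + V y / (k + 1) < 0 := hk hy
    rw [div_eq_inv_mul] at h1
    have := mul_nonpos_of_nonneg_of_nonpos (sq_nonneg a) h1.le
    linarith

lemma tendsto_zero_of_deriv_le_neg_mul {V : ℝ → ℝ} (hV : Differentiable ℝ V) {ε : ℝ} (hε : 0 < ε)
    (hV0 : ∀ t, 0 ≤ V t) (h : ∀ t, 0 ≤ t → deriv V t ≤ -ε * V t) :
    Filter.Tendsto V Filter.atTop (nhds 0) := by
  have hd : ∀ t, HasDerivAt (fun t => Real.exp (ε * t) * V t)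
      (Real.exp (ε * t) * (ε * 1) * V t + Real.exp (ε * t) * deriv V t) t := fun t =>
    (((hasDerivAt_id t).const_mul ε).exp).mul (hV t).hasDerivAt
  have hanti : AntitoneOn (fun t => Real.exp (ε * t) * V t) (Set.Ici 0) := by
    refine antitoneOn_of_deriv_nonpos (convex_Ici 0)
      (fun t _ => (hd t).continuousAt.continuousWithinAt)
      (fun t _ => (hd t).differentiableAt.differentiableWithinAt) fun t ht => ?_
    rw [interior_Ici, Set.mem_Ioi] at ht
    rw [(hd t).deriv]
    have := mul_le_mul_of_nonneg_left (h t ht.le) (Real.exp_pos (ε * t)).le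
    linarith
  have hle : ∀ t, 0 ≤ t → V t ≤ V 0 * Real.exp (-(ε * t)) := by
    intro t ht
    have := hanti Set.self_mem_Ici (Set.mem_Ici.2 ht) ht
    simp only [mul_zero, Real.exp_zero, one_mul] at this
    rw [Real.exp_neg, ← div_eq_mul_inv, le_div_iff₀ (Real.exp_pos _), mul_comm]
    exact this
  have hlim : Filter.Tendsto (fun t => V 0 * Real.exp (-(ε * t))) Filter.atTop (nhds 0) := by
    have := (Real.tendsto_exp_neg_atTop_nhds_zero.comp
      (Filter.tendsto_id.const_mul_atTop hε)).const_mul (V 0)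
    rw [mul_zero] at this
    exact this
  exact tendsto_of_tendsto_of_tendsto_of_le_of_le' tendsto_const_nhds hlim
    (Filter.Eventually.of_forall hV0) (Filter.eventually_atTop.2 ⟨0, hle⟩)

lemma SimpleGraph.sum_dotProduct_laplacian {ι n : Type*} [Fintype ι] [Fintype n]
    (G : SimpleGraph ι) [DecidableRel G.Adj] (e : ι → n → ℝ) :
    ∑ i, e i ⬝ᵥ ∑ j, (if G.Adj i j then (1 : ℝ) else 0) • (e j - e i) =
      -((1 / 2) * ∑ i, ∑ j, (if G.Adj i j then (1 : ℝ) else 0) *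
        ((e i - e j) ⬝ᵥ (e i - e j))) := by
  have h1 : ∑ i, e i ⬝ᵥ ∑ j, (if G.Adj i j then (1 : ℝ) else 0) • (e j - e i) =
      ∑ i, ∑ j, (if G.Adj i j then (1 : ℝ) else 0) * (e i ⬝ᵥ (e j - e i)) := by
    simp only [dotProduct_sum, dotProduct_smul, smul_eq_mul]
  have h2 : ∑ i, ∑ j, (if G.Adj i j then (1 : ℝ) else 0) * (e i ⬝ᵥ (e j - e i)) =
      ∑ i, ∑ j, (if G.Adj i j then (1 : ℝ) else 0) * (e j ⬝ᵥ (e i - e j)) := by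
    rw [Finset.sum_comm]
    simp only [G.adj_comm]
  have h3 : ∑ i, ∑ j, (if G.Adj i j then (1 : ℝ) else 0) * ((e i - e j) ⬝ᵥ (e i - e j)) =
      -(∑ i, ∑ j, (if G.Adj i j then (1 : ℝ) else 0) * (e i ⬝ᵥ (e j - e i)) +
        ∑ i, ∑ j, (if G.Adj i j then (1 : ℝ) else 0) * (e j ⬝ᵥ (e i - e j))) := by
    simp only [← Finset.sum_add_distrib, ← Finset.sum_neg_distrib]
    refine Finset.sum_congr rfl fun i _ => Finset.sum_congr rfl fun j _ => ?_
    simp only [sub_dotProduct, dotProduct_sub]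
    ring
  rw [h1, h3, ← h2]
  ring

lemma SimpleGraph.Connected.exists_coupling_gain {ι n : Type*} [Fintype ι] [Fintype n]
    {G : SimpleGraph ι} [DecidableRel G.Adj] (hG : G.Connected) {c : ι → Type*}
    [∀ i, Fintype (c i)] (S : Matrix n n ℝ) (C : ∀ i, Matrix (c i) n ℝ) (μ : ℝ)
    {P : Matrix n n ℝ} (hP : P.PosDef)
    (h : ∀ x, x ≠ 0 → x ⬝ᵥ S *ᵥ x < μ * ∑ i, C i *ᵥ x ⬝ᵥ C i *ᵥ x) :
    ∃ γ ε : ℝ, 0 < γ ∧ 0 < ε ∧ ∀ e : ι → n → ℝ,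
      ∑ i, (e i ⬝ᵥ S *ᵥ e i - Fintype.card ι * μ * (C i *ᵥ e i ⬝ᵥ C i *ᵥ e i)) +
        γ * ∑ i, e i ⬝ᵥ ∑ j, (if G.Adj i j then (1 : ℝ) else 0) • (e j - e i) ≤
      -ε * ∑ i, e i ⬝ᵥ P *ᵥ e i := by
  have hdot : ∀ {m : Type _} [Fintype m] (v : m → ℝ), 0 ≤ v ⬝ᵥ v := fun v => by
    simpa using dotProduct_star_self_nonneg v
  obtain ⟨γ, ε, hγ, hε, hle⟩ := exists_penalty (E := ι → n → ℝ)
    (f := fun e => ∑ i, (e i ⬝ᵥ S *ᵥ e i - Fintype.card ι * μ * (C i *ᵥ e i ⬝ᵥ C i *ᵥ e i)))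
    (g := fun e => (1 / 2) * ∑ i, ∑ j, (if G.Adj i j then (1 : ℝ) else 0) *
        ((e i - e j) ⬝ᵥ (e i - e j)))
    (V := fun e => ∑ i, e i ⬝ᵥ P *ᵥ e i)
    (by fun_prop) (by fun_prop) (by fun_prop)
    (fun a e => by
      simp only [Pi.smul_apply, mulVec_smul, dotProduct_smul, smul_dotProduct, smul_eq_mul,
        Finset.mul_sum]
      exact Finset.sum_congr rfl fun i _ => by ring)
    (fun a e => by
      simp only [Pi.smul_apply, ← smul_sub, dotProduct_smul, smul_dotProduct, smul_eq_mul,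
        Finset.mul_sum]
      exact Finset.sum_congr rfl fun i _ => Finset.sum_congr rfl fun j _ => by ring)
    (fun a e => by
      simp only [Pi.smul_apply, mulVec_smul, dotProduct_smul, smul_dotProduct, smul_eq_mul,
        Finset.mul_sum]
      exact Finset.sum_congr rfl fun i _ => by ring)
    (fun e => mul_nonneg (by norm_num) (Finset.sum_nonneg fun i _ => Finset.sum_nonneg fun j _ =>
      mul_nonneg (by split_ifs <;> simp) (hdot _)))
    (fun e => Finset.sum_nonneg fun i _ => by
      simpa using hP.posSemidef.dotProduct_mulVec_nonneg (e i))
    (fun e he hg => by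
      have hnn : ∀ i j, 0 ≤ (if G.Adj i j then (1 : ℝ) else 0) * ((e i - e j) ⬝ᵥ (e i - e j)) :=
        fun i j => mul_nonneg (by split_ifs <;> simp) (hdot _)
      have hadj : ∀ i j, G.Adj i j → e i = e j := by
        intro i j hij
        have h1 := (Finset.sum_eq_zero_iff_of_nonneg fun i _ => Finset.sum_nonneg fun j _ =>
          hnn i j).1 ((mul_eq_zero_iff_left (by norm_num)).1 hg) i (Finset.mem_univ i)
        have h2 := (Finset.sum_eq_zero_iff_of_nonneg fun j _ => hnn i j).1 h1 j (Finset.mem_univ j)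
        rw [if_pos hij, one_mul, dotProduct_self_eq_zero] at h2
        exact sub_eq_zero.1 h2
      obtain ⟨i₀⟩ := hG.nonempty
      have hconst : ∀ i, e i = e i₀ := fun i => by
        obtain ⟨w⟩ := hG.preconnected i i₀
        induction w with
        | nil => rfl
        | cons hij _ ih => rw [hadj _ _ hij, ih]
      have hne : e i₀ ≠ 0 := fun h0 => he (funext fun i => (hconst i).trans h0)
      have hcard : (0 : ℝ) < Fintype.card ι := by
        have : Nonempty ι := ⟨i₀⟩
        exact_mod_cast Fintype.card_pos
      simp only [hconst, Finset.sum_sub_distrib, Finset.sum_const, Finset.card_univ,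
        nsmul_eq_mul, ← Finset.mul_sum]
      have := mul_lt_mul_of_pos_left (h _ hne) hcard
      linarith)
  refine ⟨γ, ε, hγ, hε, fun e => ?_⟩
  rw [G.sum_dotProduct_laplacian]
  linarith [hle e]

lemma HasDerivAt.dotProduct_real {n : Type*} [Fintype n] {u v : ℝ → n → ℝ} {u' v' : n → ℝ} {t : ℝ}
    (hu : HasDerivAt u u' t) (hv : HasDerivAt v v' t) :
    HasDerivAt (fun s => u s ⬝ᵥ v s) (u' ⬝ᵥ v t + u t ⬝ᵥ v') t := by
  simp only [dotProduct, ← Finset.sum_add_distrib]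
  exact HasDerivAt.fun_sum fun i _ => (hasDerivAt_pi.1 hu i).mul (hasDerivAt_pi.1 hv i)

lemma HasDerivAt.mulVec_real {m n : Type*} [Fintype m] [Fintype n] (M : Matrix m n ℝ)
    {u : ℝ → n → ℝ} {u' : n → ℝ} {t : ℝ} (hu : HasDerivAt u u' t) :
    HasDerivAt (fun s => M *ᵥ u s) (M *ᵥ u') t :=
  M.mulVecLin.toContinuousLinearMap.hasFDerivAt.comp_hasDerivAt t hu

lemma Matrix.PosDef.exists_norm_sq_le {ι n : Type*} [Fintype ι] [Fintype n] {P : Matrix n n ℝ}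
    (hP : P.PosDef) : ∃ ε : ℝ, 0 < ε ∧ ∀ e : ι → n → ℝ, ε * ‖e‖ ^ 2 ≤ ∑ i, e i ⬝ᵥ P *ᵥ e i := by
  have hnn : ∀ x : n → ℝ, 0 ≤ x ⬝ᵥ P *ᵥ x := fun x => by
    simpa using hP.posSemidef.dotProduct_mulVec_nonneg x
  obtain ⟨_, ε, _, hε, hle⟩ := exists_penalty (E := ι → n → ℝ)
    (f := fun e => -∑ i, e i ⬝ᵥ P *ᵥ e i) (g := fun _ => 0) (V := fun e => ‖e‖ ^ 2)
    (by fun_prop) (by fun_prop) (by fun_prop)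
    (fun a e => by
      simp only [Pi.smul_apply, mulVec_smul, dotProduct_smul, smul_dotProduct, smul_eq_mul,
        Finset.mul_sum, mul_neg, ← mul_assoc, sq])
    (fun a e => by simp) (fun a e => by simp [norm_smul, mul_pow]) (fun _ => le_rfl)
    (fun e => by positivity)
    (fun e he _ => by
      obtain ⟨i, hi⟩ := Function.ne_iff.1 he
      refine neg_neg_of_pos (Finset.sum_pos' (fun j _ => hnn _) ⟨i, Finset.mem_univ i, ?_⟩)
      simpa using hP.dotProduct_mulVec_pos hi)
  exact ⟨ε, hε, fun e => by linarith [hle e]⟩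

/-- Diffusive coupling with a large gain drives the estimation errors of a connected network to
zero. -/
lemma SimpleGraph.Connected.exists_gain_tendsto_zero {ι n : Type*} [Fintype ι] [Fintype n]
    [DecidableEq n] {G : SimpleGraph ι} [DecidableRel G.Adj] (hG : G.Connected) {c : ι → Type*}
    [∀ i, Fintype (c i)] (F : Matrix n n ℝ) (C : ∀ i, Matrix (c i) n ℝ) (μ : ℝ)
    {P : Matrix n n ℝ} (hP : P.PosDef)
    (h : ∀ x, x ≠ 0 → x ⬝ᵥ (P * F) *ᵥ x < μ * ∑ i, C i *ᵥ x ⬝ᵥ C i *ᵥ x) :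
    ∃ γ : ℝ, 0 < γ ∧ ∀ e : ι → ℝ → n → ℝ, (∀ i, Differentiable ℝ (e i)) →
      (∀ i t, 0 ≤ t → deriv (e i) t = F *ᵥ e i t -
        (((Fintype.card ι * μ) • (P⁻¹ * (C i)ᵀ)) * C i) *ᵥ e i t +
        γ • P⁻¹ *ᵥ ∑ j, (if G.Adj i j then (1 : ℝ) else 0) • (e j t - e i t)) →
      ∀ i, Filter.Tendsto (e i) Filter.atTop (nhds 0) := by
  obtain ⟨γ, ε, hγ, hε, hle⟩ := hG.exists_coupling_gain (P * F) C μ hP h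
  obtain ⟨δ, hδ, hnorm⟩ := hP.exists_norm_sq_le (ι := ι)
  refine ⟨γ, hγ, fun e he hode => ?_⟩
  have hPT : Pᵀ = P := hP.isHermitian.eq
  have hPdet : IsUnit P.det := (P.isUnit_iff_isUnit_det).1 hP.isUnit
  have hnn : ∀ x : n → ℝ, 0 ≤ x ⬝ᵥ P *ᵥ x := fun x => by
    simpa using hP.posSemidef.dotProduct_mulVec_nonneg x
  let V : ℝ → ℝ := fun t => ∑ i, e i t ⬝ᵥ P *ᵥ e i t
  have hV : ∀ t, HasDerivAt V (2 * ∑ i, e i t ⬝ᵥ P *ᵥ deriv (e i) t) t := by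
    intro t
    rw [Finset.mul_sum]
    refine HasDerivAt.fun_sum fun i _ => ?_
    have hi := (he i t).hasDerivAt
    have := hi.dotProduct_real (hi.mulVec_real P)
    have hsymm : deriv (e i) t ⬝ᵥ P *ᵥ e i t = e i t ⬝ᵥ P *ᵥ deriv (e i) t := by
      rw [dotProduct_mulVec, dotProduct_comm, ← mulVec_transpose, hPT]
    rwa [hsymm, ← two_mul] at this
  have hVlim : Filter.Tendsto V Filter.atTop (nhds 0) := by
    refine tendsto_zero_of_deriv_le_neg_mul (fun t => (hV t).differentiableAt)
      (mul_pos two_pos hε) (fun t => Finset.sum_nonneg fun i _ => hnn _) fun t ht => ?_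
    rw [(hV t).deriv]
    have hterm : ∀ i, e i t ⬝ᵥ P *ᵥ deriv (e i) t =
        (e i t ⬝ᵥ (P * F) *ᵥ e i t - Fintype.card ι * μ * (C i *ᵥ e i t ⬝ᵥ C i *ᵥ e i t)) +
        γ * (e i t ⬝ᵥ ∑ j, (if G.Adj i j then (1 : ℝ) else 0) • (e j t - e i t)) := by
      intro i
      have h1 : P * (((Fintype.card ι * μ) • (P⁻¹ * (C i)ᵀ)) * C i) =
          (Fintype.card ι * μ) • ((C i)ᵀ * C i) := by
        rw [Matrix.smul_mul, Matrix.mul_smul, Matrix.mul_assoc P⁻¹, ← Matrix.mul_assoc P,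
          mul_nonsing_inv _ hPdet, Matrix.one_mul]
      rw [hode i t ht, mulVec_add, mulVec_sub, mulVec_smul, mulVec_mulVec, mulVec_mulVec,
        mulVec_mulVec, mul_nonsing_inv _ hPdet, one_mulVec, h1, dotProduct_add, dotProduct_sub,
        dotProduct_smul, smul_mulVec, dotProduct_smul, ← mulVec_mulVec (e i t) (C i)ᵀ,
        dotProduct_mulVec (e i t) (C i)ᵀ, vecMul_transpose, smul_eq_mul, smul_eq_mul]
    rw [Finset.sum_congr rfl fun i _ => hterm i, Finset.sum_add_distrib, ← Finset.mul_sum]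
    have := hle fun i => e i t
    simp only [V]
    linarith
  intro i
  rw [tendsto_zero_iff_norm_tendsto_zero]
  have hbound : ∀ t, ‖e i t‖ ≤ Real.sqrt (δ⁻¹ * V t) := fun t => by
    refine Real.le_sqrt_of_sq_le ?_
    rw [inv_mul_eq_div, le_div_iff₀ hδ, mul_comm]
    refine le_trans ?_ (hnorm fun i => e i t)
    gcongr
    exact norm_le_pi_norm (fun i => e i t) i
  refine squeeze_zero (fun _ => norm_nonneg _) hbound ?_
  have := (Real.continuous_sqrt.tendsto _).comp (hVlim.const_mul δ⁻¹)
  rw [mul_zero, Real.sqrt_zero] at this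
  exact this

/-- **Theorem 3, sufficiency.** For a connected simple communication
graph on `{1, …, l}` and a jointly partially detectable distributed plant
`x' = Ax + Bu`, `y_i = C_i x + D_i u`, `z = Kx`, there exist estimator parameters
`N_i, M_i, H_i, L_i, R_i` and a coupling gain `γ > 0` such that the network of local
estimators achieves omniscience asymptotically: `R_i w_i(t) − Kx(t) → 0` for all `i`. -/
theorem stmt_11 (l n m r : ℕ) (hl : 1 ≤ l) (p : Fin l → ℕ)
    (G : SimpleGraph (Fin l)) [DecidableRel G.Adj] (hconn : G.Connected)
    (A : Matrix (Fin n) (Fin n) ℝ) (B : Matrix (Fin n) (Fin m) ℝ)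
    (C : (i : Fin l) → Matrix (Fin (p i)) (Fin n) ℝ)
    (D : (i : Fin l) → Matrix (Fin (p i)) (Fin m) ℝ)
    (K : Matrix (Fin r) (Fin n) ℝ)
    (hdet : ∀ lam : ℂ, 0 ≤ lam.re → ∀ v : Fin n → ℂ,
      (∀ j : ℕ, j < n → ∀ i : Fin l,
        (((C i).map Complex.ofReal) *
          (lam • (1 : Matrix (Fin n) (Fin n) ℂ) - A.map Complex.ofReal) ^ j).mulVec v = 0) →
      ((lam • (1 : Matrix (Fin n) (Fin n) ℂ) - A.map Complex.ofReal) ^ n).mulVec v = 0 →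
      (K.map Complex.ofReal).mulVec v = 0) :
    ∃ (q : ℕ) (N M : Fin l → Matrix (Fin q) (Fin q) ℝ)
      (H : Fin l → Matrix (Fin q) (Fin m) ℝ)
      (L : (i : Fin l) → Matrix (Fin q) (Fin (p i)) ℝ)
      (R : Fin l → Matrix (Fin r) (Fin q) ℝ) (γ : ℝ),
      0 < γ ∧
      ∀ u : ℝ → (Fin m → ℝ), Continuous u →
      ∀ x : ℝ → (Fin n → ℝ), Differentiable ℝ x →
      (∀ t : ℝ, 0 ≤ t → deriv x t = A.mulVec (x t) + B.mulVec (u t)) →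
      ∀ w : Fin l → ℝ → (Fin q → ℝ), (∀ i, Differentiable ℝ (w i)) →
      (∀ i : Fin l, ∀ t : ℝ, 0 ≤ t →
        deriv (w i) t =
          (N i).mulVec (w i t) + (H i).mulVec (u t) +
          (L i).mulVec ((C i).mulVec (x t) + (D i).mulVec (u t)) +
          γ • (M i).mulVec (∑ j : Fin l,
            (if G.Adj i j then (1 : ℝ) else 0) • (w j t - w i t))) →
      ∀ i : Fin l,
        Filter.Tendsto (fun t => (R i).mulVec (w i t) - K.mulVec (x t))
          Filter.atTop (nhds 0) := by
  let Ct : Matrix ((i : Fin l) × Fin (p i)) (Fin n) ℝ := of fun k => C k.1 k.2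
  obtain ⟨Q, F, hFQ, hCQ, hKQ, hF⟩ := detectable_of_partially_detectable A Ct K
    (fun lam hlam v hC hv => hdet lam hlam v
      (fun j _ i => funext fun k => congrFun (hC j) ⟨i, k⟩) (by rwa [Fintype.card_fin] at hv))
  have hCQi : ∀ i, C i * Q = C i := fun i =>
    funext fun k => congrFun hCQ (⟨i, k⟩ : (i : Fin l) × Fin (p i))
  obtain ⟨P, μ, hP, hlyap⟩ := exists_posDef_lyapunov_of_detectable F Ct hF
  have hCt : ∀ x, Ct *ᵥ x ⬝ᵥ Ct *ᵥ x = ∑ i, C i *ᵥ x ⬝ᵥ C i *ᵥ x := fun x =>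
    Fintype.sum_sigma _
  obtain ⟨γ, hγ, hconv⟩ := hconn.exists_gain_tendsto_zero F C μ hP
    (fun x hx => by rw [← hCt]; exact hlyap x hx)
  let L : (i : Fin l) → Matrix (Fin n) (Fin (p i)) ℝ := fun i =>
    (Fintype.card (Fin l) * μ) • (P⁻¹ * (C i)ᵀ)
  refine ⟨n, fun i => F - L i * C i, fun _ => P⁻¹, fun i => Q * B - L i * D i, L, fun _ => K, γ,
    hγ, fun u _ x hx hxode w hw hwode i => ?_⟩
  have hQx : ∀ t, HasDerivAt (fun s => Q *ᵥ x s) (Q *ᵥ deriv x t) t := fun t =>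
    (hx t).hasDerivAt.mulVec_real Q
  have he : ∀ i t, HasDerivAt (fun s => w i s - Q *ᵥ x s) (deriv (w i) t - Q *ᵥ deriv x t) t :=
    fun i t => (hw i t).hasDerivAt.sub (hQx t)
  have hlim := hconv (fun i t => w i t - Q *ᵥ x t) (fun i t => (he i t).differentiableAt)
    (fun i t ht => by
      rw [(he i t).deriv, hwode i t ht, hxode t ht]
      simp only [sub_sub_sub_cancel_right, mulVec_add, mulVec_sub, sub_mulVec, mulVec_mulVec, hFQ]
      rw [Matrix.mul_assoc (L i), hCQi]
      abel) i
  have hK := ((continuous_const (y := K)).matrix_mulVec continuous_id).tendsto 0 |>.comp hlim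
  refine (hK.congr fun t => ?_).trans_eq ?_
  · simp [mulVec_sub, mulVec_mulVec, hKQ]
  · simp
end
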